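/- There exist constants C > 0 and N such that for all n ≥ N the following holds: if A ∈ {−1,1}^{n×n} is a sign matrix whose rows A_i satisfy max_{i≠j} |⟨A_i, A_j⟩| ≤ √(10·n·log n), then the row-normalized matrix Â = A/√n satisfies |β(Â) − ( √(2·log(2n)) − log(log(2n))/(2·√(2·log(2n))) )| ≤ C/√(log n). -/

import Mathlib

open Finset

noncomputable section
open scoped Classical

/-- The sign `±1` associated to a Boolean. -/
def sgn (b : Bool) : ℝ := if b then 1 else -1

/-- The hypercube `{-1,1}^n` as a finite set of vectors in `ℝ^n`. -/
def cube (n : ℕ) : Finset (Fin n → ℝ) :=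
  (Finset.univ : Finset (Fin n → Bool)).image (fun ε i => sgn (ε i))

/-- `β(A) = 2^{-n} ∑_{x ∈ {-1,1}^n} ‖Ax‖_∞` (the `Pi` norm on `Fin n → ℝ` is the sup norm). -/
def badBeta {n : ℕ} (A : Matrix (Fin n) (Fin n) ℝ) : ℝ :=
  (2 ^ n : ℝ)⁻¹ * ∑ x ∈ cube n, ‖A.mulVec x‖

/-- The cell `S_i(A) = {x ∈ {-1,1}^n : ‖Ax‖_∞ = ⟨a_i, x⟩}`. -/
def cellS {n : ℕ} (A : Matrix (Fin n) (Fin n) ℝ) (i : Fin n) : Finset (Fin n → ℝ) :=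
  (cube n).filter (fun x => ‖A.mulVec x‖ = ∑ j, A i j * x j)

/-- `A` is tie-free: no two distinct rows attain the same absolute inner product with a
hypercube vertex. -/
def TieFree {n : ℕ} (A : Matrix (Fin n) (Fin n) ℝ) : Prop :=
  ∀ x ∈ cube n, ∀ i j : Fin n, i ≠ j →
    (∑ k, A i k * x k) ^ 2 ≠ (∑ k, A j k * x k) ^ 2

/-- Level-1 Fourier weight of `f : {-1,1}^n → ℝ`. -/
def W1 {n : ℕ} (f : (Fin n → ℝ) → ℝ) : ℝ :=
  ∑ i : Fin n, ((2 ^ n : ℝ)⁻¹ * ∑ x ∈ cube n, f x * x i) ^ 2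


theorem stirling_upper (n : ℕ) (hn : n ≠ 0) :
    Real.log (n.factorial) ≤ n * Real.log n - n + Real.log n / 2 + Real.log (2 * Real.pi) / 2
      + 1 / (12 * n) := by
  have key : Real.log (Stirling.stirlingSeq n) ≤ Real.log (Real.sqrt Real.pi) + 1 / (12 * n) := by
    -- sequence a_k = log s_k - 1/(12k) is monotone
    have hmono : Monotone (fun k : ℕ => Real.log (Stirling.stirlingSeq (n + k)) - 1 / (12 * ((n + k : ℕ) : ℝ))) := by
      apply monotone_nat_of_le_succ
      intro k
      have h := Stirling.log_stirlingSeq_sdiff_le (n + k)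
      have hpos : (0 : ℝ) < ((n + k : ℕ) : ℝ) := by
        have : 0 < n + k := by omega
        exact_mod_cast this
      have e : 1 / (12 * ((n + k : ℕ) : ℝ) * (((n + k : ℕ) : ℝ) + 1))
          = 1 / (12 * ((n + k : ℕ) : ℝ)) - 1 / (12 * (((n + k : ℕ) : ℝ) + 1)) := by
        field_simp
        ring
      have e2 : ((n + (k + 1) : ℕ) : ℝ) = ((n + k : ℕ) : ℝ) + 1 := by push_cast; ring
      rw [e2]
      rw [e] at h
      have : n + (k + 1) = n + k + 1 := rfl
      rw [this]
      linarith
    have hlim : Filter.Tendsto (fun k : ℕ => Real.log (Stirling.stirlingSeq (n + k)) - 1 / (12 * ((n + k : ℕ) : ℝ)))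
        Filter.atTop (nhds (Real.log (Real.sqrt Real.pi) - 0)) := by
      have hshift : Filter.Tendsto (fun k : ℕ => n + k) Filter.atTop Filter.atTop :=
        Filter.tendsto_atTop_mono (fun k => by simp) Filter.tendsto_id
      have h1 := ((Stirling.tendsto_stirlingSeq_sqrt_pi.log
        (by positivity)).comp hshift)
      have h2 : Filter.Tendsto (fun k : ℕ => 1 / (12 * (k : ℝ))) Filter.atTop (nhds 0) := by
        have := (tendsto_one_div_atTop_nhds_zero_nat (𝕜 := ℝ)).const_mul (1/12)
        simp only [mul_zero] at this
        refine this.congr (fun k => ?_)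
        ring
      exact h1.sub (h2.comp hshift)
    have := hmono.ge_of_tendsto hlim 0
    simp only [add_zero, sub_zero] at this
    linarith
  rw [Stirling.log_stirlingSeq_formula] at key
  have hn' : (0 : ℝ) < n := by positivity
  rw [Real.log_sqrt (by positivity), Real.log_mul (by norm_num) hn'.ne',
    Real.log_div hn'.ne' (Real.exp_pos 1).ne', Real.log_exp] at key
  rw [Real.log_mul (by norm_num) (by positivity)]
  linarith

theorem log_le_cubic {x : ℝ} (hx : -1 < x) : Real.log (1 + x) ≤ x - x ^ 2 / 2 + x ^ 3 / 3 := by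
  let f : ℝ → ℝ := fun x => x - x ^ 2 / 2 + x ^ 3 / 3 - Real.log (1 + x)
  have hd : ∀ y, -1 < y → HasDerivAt f (y ^ 3 / (1 + y)) y := by
    intro y hy
    have h1 : HasDerivAt (fun x : ℝ => Real.log (1 + x)) (1 / (1 + y)) y :=
      ((hasDerivAt_id y).const_add 1).log (by simp only [id]; linarith)
    have h2 := (((hasDerivAt_id y).sub ((hasDerivAt_pow 2 y).div_const 2)).add
      ((hasDerivAt_pow 3 y).div_const 3)).sub h1
    refine h2.congr_deriv ?_
    have : (1 + y) ≠ 0 := by linarith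
    field_simp
    push_cast
    ring
  have h0 : f 0 = 0 := by simp [f]
  suffices 0 ≤ f x by simp only [f] at this; linarith
  rcases le_total 0 x with h | h
  · have : MonotoneOn f (Set.Ici 0) := by
      apply monotoneOn_of_deriv_nonneg (convex_Ici 0)
      · intro y hy
        exact (hd y (by have : (0:ℝ) ≤ y := hy; linarith)).continuousAt.continuousWithinAt
      · intro y hy
        rw [interior_Ici] at hy
        exact (hd y (by have : (0:ℝ) < y := hy; linarith)).differentiableAt.differentiableWithinAt
      · intro y hy
        rw [interior_Ici] at hy
        have hy : (0:ℝ) < y := hy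
        rw [(hd y (by linarith)).deriv]
        positivity
    have := this (Set.mem_Ici.2 le_rfl) (Set.mem_Ici.2 h) h
    linarith
  · have : AntitoneOn f (Set.Icc x 0) := by
      apply antitoneOn_of_deriv_nonpos (convex_Icc x 0)
      · intro y hy
        exact (hd y (by linarith [hy.1])).continuousAt.continuousWithinAt
      · intro y hy
        rw [interior_Icc] at hy
        exact (hd y (by linarith [hy.1])).differentiableAt.differentiableWithinAt
      · intro y hy
        rw [interior_Icc] at hy
        rw [(hd y (by linarith [hy.1])).deriv]
        have h1 : 0 < 1 + y := by linarith [hy.1]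
        have h2 : y ^ 3 ≤ 0 := by
          have := hy.2
          nlinarith [sq_nonneg y]
        exact div_nonpos_of_nonpos_of_nonneg h2 h1.le
    have := this (Set.left_mem_Icc.2 h) (Set.right_mem_Icc.2 h) h
    linarith

theorem log_ge_quartic {x : ℝ} (hx : -(1/2) ≤ x) :
    x - x ^ 2 / 2 + x ^ 3 / 3 - x ^ 4 / 2 ≤ Real.log (1 + x) := by
  let f : ℝ → ℝ := fun x => Real.log (1 + x) - (x - x ^ 2 / 2 + x ^ 3 / 3 - x ^ 4 / 2)
  have hd : ∀ y, -1 < y → HasDerivAt f (y ^ 3 * (1 + 2 * y) / (1 + y)) y := by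
    intro y hy
    have h1 : HasDerivAt (fun x : ℝ => Real.log (1 + x)) (1 / (1 + y)) y :=
      ((hasDerivAt_id y).const_add 1).log (by simp only [id]; linarith)
    have h2 := h1.sub ((((hasDerivAt_id y).sub ((hasDerivAt_pow 2 y).div_const 2)).add
      ((hasDerivAt_pow 3 y).div_const 3)).sub ((hasDerivAt_pow 4 y).div_const 2))
    refine h2.congr_deriv ?_
    have : (1 + y) ≠ 0 := by linarith
    field_simp
    push_cast
    ring
  have h0 : f 0 = 0 := by simp [f]
  suffices 0 ≤ f x by simp only [f] at this; linarith
  rcases le_total 0 x with h | h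
  · have : MonotoneOn f (Set.Ici 0) := by
      apply monotoneOn_of_deriv_nonneg (convex_Ici 0)
      · intro y hy
        exact (hd y (by have : (0:ℝ) ≤ y := hy; linarith)).continuousAt.continuousWithinAt
      · intro y hy
        rw [interior_Ici] at hy
        exact (hd y (by have : (0:ℝ) < y := hy; linarith)).differentiableAt.differentiableWithinAt
      · intro y hy
        rw [interior_Ici] at hy
        have hy : (0:ℝ) < y := hy
        rw [(hd y (by linarith)).deriv]
        positivity
    have := this (Set.mem_Ici.2 le_rfl) (Set.mem_Ici.2 h) h
    linarith
  · have : AntitoneOn f (Set.Icc x 0) := by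
      apply antitoneOn_of_deriv_nonpos (convex_Icc x 0)
      · intro y hy
        exact (hd y (by linarith [hy.1])).continuousAt.continuousWithinAt
      · intro y hy
        rw [interior_Icc] at hy
        exact (hd y (by linarith [hy.1])).differentiableAt.differentiableWithinAt
      · intro y hy
        rw [interior_Icc] at hy
        rw [(hd y (by linarith [hy.1])).deriv]
        have h1 : 0 < 1 + y := by linarith [hy.1]
        have h2 : y ^ 3 ≤ 0 := by
          have := hy.2
          nlinarith [sq_nonneg y]
        have h3 : 0 ≤ 1 + 2 * y := by linarith [hy.1]
        exact div_nonpos_of_nonpos_of_nonneg (mul_nonpos_of_nonpos_of_nonneg h2 h3) h1.le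
    have := this (Set.left_mem_Icc.2 h) (Set.right_mem_Icc.2 h) h
    linarith

theorem entropy_bound {x : ℝ} (hx : |x| ≤ 1 / 2) :
    |(1 + x) * Real.log (1 + x) + (1 - x) * Real.log (1 - x) - x ^ 2| ≤ x ^ 4 := by
  obtain ⟨h1, h2⟩ := abs_le.1 hx
  have a1 := log_le_cubic (x := x) (by linarith)
  have a2 := log_le_cubic (x := -x) (by linarith)
  have b1 := log_ge_quartic (x := x) (by linarith)
  have b2 := log_ge_quartic (x := -x) (by linarith)
  have e : 1 + -x = 1 - x := by ring
  rw [e] at a2 b2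
  have p1 : 0 ≤ 1 + x := by linarith
  have p2 : 0 ≤ 1 - x := by linarith
  have c1 := mul_le_mul_of_nonneg_left a1 p1
  have c2 := mul_le_mul_of_nonneg_left a2 p2
  have d1 := mul_le_mul_of_nonneg_left b1 p1
  have d2 := mul_le_mul_of_nonneg_left b2 p2
  have : 0 ≤ x ^ 4 := by positivity
  rw [abs_le]
  constructor <;> nlinarith

theorem log_one_sub_bound {y : ℝ} (h0 : 0 ≤ y) (h1 : y ≤ 1 / 2) :
    |Real.log (1 - y)| ≤ 2 * y := by
  have hl : Real.log (1 - y) ≤ 0 := Real.log_nonpos (by linarith) (by linarith)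
  rw [abs_of_nonpos hl]
  have := Real.one_sub_inv_le_log_of_pos (x := 1 - y) (by linarith)
  have h3 : (1 - y)⁻¹ ≤ 1 + 2 * y := by
    rw [inv_le_iff_one_le_mul₀ (by linarith)]
    nlinarith
  linarith

/-- normalized binomial -/
def pb (n j : ℕ) : ℝ := (n.choose j : ℝ) / 2 ^ n

/-- log of the Gaussian local density -/
def GG (n k : ℝ) : ℝ := -(Real.log n) / 2 + Real.log 2 - Real.log (2 * Real.pi) / 2 - k ^ 2 / (2 * n)

theorem pb_pos {n j : ℕ} (h : j ≤ n) : 0 < pb n j := by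
  unfold pb
  have : 0 < n.choose j := Nat.choose_pos h
  positivity

theorem pb_nonneg (n j : ℕ) : 0 ≤ pb n j := by
  unfold pb
  positivity

set_option maxHeartbeats 1000000 in
theorem llt (n j : ℕ) (hn : 0 < n) (hk : 2 * |2 * (j : ℝ) - n| ≤ n) :
    |Real.log (pb n j) - GG n (2 * j - n)| ≤
      (2 * (j : ℝ) - n) ^ 4 / (2 * n ^ 3) + (2 * (j : ℝ) - n) ^ 2 / n ^ 2 + 1 / n := by
  have hn' : (0 : ℝ) < n := by exact_mod_cast hn
  set k : ℝ := 2 * (j : ℝ) - n with hkdef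
  obtain ⟨hk1, hk2⟩ := abs_le.1 (show |k| ≤ n / 2 by linarith)
  have hjn : j ≤ n := by
    have : (j : ℝ) ≤ n := by linarith
    exact_mod_cast this
  have hj0 : 0 < j := by
    have : (0 : ℝ) < j := by linarith
    exact_mod_cast this
  obtain ⟨i, rfl⟩ := Nat.exists_eq_add_of_le hjn
  set N : ℝ := ((j + i : ℕ) : ℝ) with hN
  have hNe : N = j + i := by push_cast [hN]; ring
  have hi0 : 0 < i := by
    have : (0 : ℝ) < i := by linarith
    exact_mod_cast this
  have hj' : (0 : ℝ) < j := by exact_mod_cast hj0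
  have hi' : (0 : ℝ) < i := by exact_mod_cast hi0
  have hch : Real.log (pb (j + i) j) = Real.log ((j + i).factorial) - Real.log (j.factorial)
      - Real.log (i.factorial) - N * Real.log 2 := by
    unfold pb
    have hc : ((j + i).choose j : ℝ) = (j + i).factorial / (j.factorial * i.factorial) := by
      rw [Nat.cast_choose ℝ (Nat.le_add_right j i)]
      simp
    rw [hc, Real.log_div (by positivity) (by positivity), Real.log_div (by positivity) (by positivity),
      Real.log_mul (by positivity) (by positivity), Real.log_pow]
    ring
  have sN1 := stirling_upper (j + i) (by omega)
  have sN2 := Stirling.le_log_factorial_stirling (n := j + i) (by omega)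
  have sj1 := stirling_upper j (by omega)
  have sj2 := Stirling.le_log_factorial_stirling (n := j) (by omega)
  have si1 := stirling_upper i (by omega)
  have si2 := Stirling.le_log_factorial_stirling (n := i) (by omega)
  rw [← hN] at sN1 sN2
  set x : ℝ := k / N with hx
  have hkx : k = N * x := by rw [hx]; field_simp
  have hxabs : |x| ≤ 1 / 2 := by
    rw [hx, abs_div, abs_of_pos hn', div_le_iff₀ hn']
    linarith
  obtain ⟨hx1, hx2⟩ := abs_le.1 hxabs
  have hjx : (j : ℝ) = N * (1 + x) / 2 := by
    have : N * (1 + x) = N + k := by rw [hkx]; ring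
    rw [this]; linarith
  have hix : (i : ℝ) = N * (1 - x) / 2 := by
    have : N * (1 - x) = N - k := by rw [hkx]; ring
    rw [this]; linarith
  have lj : Real.log j = Real.log N - Real.log 2 + Real.log (1 + x) := by
    rw [hjx, Real.log_div (by nlinarith) (by norm_num), Real.log_mul hn'.ne' (by linarith)]; ring
  have li : Real.log i = Real.log N - Real.log 2 + Real.log (1 - x) := by
    rw [hix, Real.log_div (by nlinarith) (by norm_num), Real.log_mul hn'.ne' (by linarith)]; ring
  have hent := entropy_bound hxabs
  have hlx : |Real.log (1 + x) + Real.log (1 - x)| ≤ 2 * x ^ 2 := by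
    rw [← Real.log_mul (by linarith) (by linarith)]
    have : (1 + x) * (1 - x) = 1 - x ^ 2 := by ring
    rw [this]
    exact log_one_sub_bound (by positivity) (by nlinarith)
  have e1 : k ^ 4 / (2 * N ^ 3) = N / 2 * x ^ 4 := by rw [hkx]; field_simp
  have e2 : k ^ 2 / N ^ 2 = x ^ 2 := by rw [hkx]; field_simp
  have e3 : k ^ 2 / (2 * N) = N / 2 * x ^ 2 := by rw [hkx]; field_simp
  have bj : 1 / (12 * (j : ℝ)) ≤ 1 / (3 * N) := by
    apply one_div_le_one_div_of_le <;> linarith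
  have bi : 1 / (12 * (i : ℝ)) ≤ 1 / (3 * N) := by
    apply one_div_le_one_div_of_le <;> linarith
  have bN : 1 / (12 * N) ≤ 1 / (3 * N) := by
    apply one_div_le_one_div_of_le <;> linarith
  have b3 : 1 / (3 * N) = 1 / N / 3 := by field_simp
  have bpos : 0 < 1 / N := by positivity
  rw [hch]
  unfold GG
  rw [e1, e2, e3]
  set H := (1 + x) * Real.log (1 + x) + (1 - x) * Real.log (1 - x) with hH
  have hjl : (j : ℝ) * Real.log j + i * Real.log i = N * (Real.log N - Real.log 2) + N / 2 * H := by
    rw [lj, li, hjx, hix, hH]; ring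
  have hll : Real.log j + Real.log i = 2 * Real.log N - 2 * Real.log 2 + (Real.log (1 + x) + Real.log (1 - x)) := by
    rw [lj, li]; ring
  obtain ⟨q1, q2⟩ := abs_le.1 hlx
  have hent' : |N / 2 * H - N / 2 * x ^ 2| ≤ N / 2 * x ^ 4 := by
    rw [← mul_sub, abs_mul, abs_of_pos (by positivity : 0 < N / 2)]
    exact mul_le_mul_of_nonneg_left hent (by positivity)
  obtain ⟨r1, r2⟩ := abs_le.1 hent'
  rw [abs_le]
  constructor <;> linarith


theorem err_bound {m U n L : ℝ} (hn : 0 < n) (hL : 1 ≤ L) (hm : n / 4 ≤ m) (hU : U ^ 2 ≤ 4 * L * n) :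
    U ^ 4 / (2 * m ^ 3) + U ^ 2 / m ^ 2 + 1 / m ≤ 580 * L ^ 2 / n := by
  have hm0 : 0 < m := by linarith
  have h1 : U ^ 4 / (2 * m ^ 3) ≤ 512 * L ^ 2 / n := by
    have : U ^ 4 ≤ (4 * L * n) ^ 2 := by
      have : U ^ 4 = (U ^ 2) ^ 2 := by ring
      rw [this]
      exact pow_le_pow_left₀ (by positivity) hU 2
    have h3 : (n / 4) ^ 3 ≤ m ^ 3 := pow_le_pow_left₀ (by positivity) hm 3
    calc U ^ 4 / (2 * m ^ 3) ≤ (4 * L * n) ^ 2 / (2 * (n / 4) ^ 3) := by gcongr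
      _ = 512 * L ^ 2 / n := by field_simp; norm_num
  have h2 : U ^ 2 / m ^ 2 ≤ 64 * L / n := by
    calc U ^ 2 / m ^ 2 ≤ (4 * L * n) / (n / 4) ^ 2 := by gcongr
      _ = 64 * L / n := by field_simp; norm_num
  have h3 : 1 / m ≤ 4 / n := by
    calc 1 / m ≤ 1 / (n / 4) := by gcongr
      _ = 4 / n := by field_simp
  have h4 : 512 * L ^ 2 / n + 64 * L / n + 4 / n ≤ 580 * L ^ 2 / n := by
    rw [← add_div, ← add_div]
    gcongr
    nlinarith
  linarith

set_option maxHeartbeats 1000000 in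
theorem pair_bound (m l s r : ℕ) (hr : r ≤ l) (L w : ℝ)
    (hL : 1 ≤ L) (hw : 0 < w) (hw2 : w ^ 2 * ((m + l : ℕ) : ℝ) = 10 * L) (hsm : 100 * w * L ≤ 1)
    (hrho : |(m : ℝ) - l| ≤ w * ((m + l : ℕ) : ℝ))
    (ha : (2 * ((s + r : ℕ) : ℝ) - ((m + l : ℕ) : ℝ)) ^ 2 ≤ 4 * L * ((m + l : ℕ) : ℝ))
    (hb : (2 * ((s + l - r : ℕ) : ℝ) - ((m + l : ℕ) : ℝ)) ^ 2 ≤ 4 * L * ((m + l : ℕ) : ℝ)) :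
    pb m s * pb l r ≤ 2 * Real.exp (20 * L * w) * (pb (m + l) (s + r) * pb (m + l) (s + l - r)) := by
  set n : ℝ := ((m + l : ℕ) : ℝ) with hn
  have hne : n = m + l := by push_cast [hn]; ring
  have hn0 : 0 < n := by
    by_contra h
    have : w ^ 2 * n ≤ 0 := mul_nonpos_of_nonneg_of_nonpos (by positivity) (by linarith)
    linarith
  have hw1 : w ≤ 1 / 100 := by nlinarith
  have hwsq : w ^ 2 ≤ 1 / 10000 := by nlinarith
  have hnbig : 100000 * L ≤ n := by
    nlinarith only [mul_le_mul_of_nonneg_right hwsq hn0.le, hw2]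
  obtain ⟨hr1, hr2⟩ := abs_le.1 hrho
  have hm4 : n / 4 ≤ m := by nlinarith
  have hl4 : n / 4 ≤ l := by nlinarith
  have hm0 : (0 : ℝ) < m := by linarith
  have hl0 : (0 : ℝ) < l := by linarith
  set U : ℝ := 2 * (s : ℝ) - m with hU
  set V : ℝ := 2 * (r : ℝ) - l with hV
  have ea : 2 * ((s + r : ℕ) : ℝ) - n = U + V := by rw [hne]; push_cast; ring
  have eb : 2 * ((s + l - r : ℕ) : ℝ) - n = U - V := by
    rw [hne, Nat.cast_sub (by omega)]; push_cast; ring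
  rw [ea] at ha
  rw [eb] at hb
  have hUV : U ^ 2 + V ^ 2 ≤ 4 * L * n := by linarith only [ha, hb]
  have hU2 : U ^ 2 ≤ 4 * L * n := by linarith only [hUV, sq_nonneg V]
  have hV2 : V ^ 2 ≤ 4 * L * n := by linarith only [hUV, sq_nonneg U]
  have hLn : 256 * L * n ≤ n ^ 2 := by nlinarith only [hnbig, hL, hn0]
  have aux : ∀ (k M : ℝ), n / 4 ≤ M → k ^ 2 ≤ 4 * L * n → 2 * |k| ≤ M := by
    intro k M hM hk
    have hM0 : 0 ≤ M := by linarith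
    have : |k| ≤ M / 2 := by
      apply abs_le_of_sq_le_sq _ (by linarith)
      have h9 : (n / 4) ^ 2 ≤ M ^ 2 := pow_le_pow_left₀ (by linarith) hM 2
      linarith
    linarith
  have hnn : n / 4 ≤ n := by linarith
  have hmlpos : 0 < m + l := by
    have : 0 < m := by exact_mod_cast hm0
    omega
  have l1 := llt m s (by exact_mod_cast hm0) (aux _ _ hm4 hU2)
  have l2 := llt l r (by exact_mod_cast hl0) (aux _ _ hl4 hV2)
  have l3 := llt (m + l) (s + r) hmlpos (aux _ _ hnn (by rw [← hn, ea]; exact ha))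
  have l4 := llt (m + l) (s + l - r) hmlpos (aux _ _ hnn (by rw [← hn, eb]; exact hb))
  rw [← hn, ea] at l3
  rw [← hn, eb] at l4
  rw [← hU] at l1
  rw [← hV] at l2
  have l1 := (le_abs_self _).trans (l1.trans (err_bound hn0 hL hm4 hU2))
  have l2 := (le_abs_self _).trans (l2.trans (err_bound hn0 hL hl4 hV2))
  have l3 := (neg_abs_le _).trans' (neg_le_neg (l3.trans (err_bound hn0 hL hnn ha)))
  have l4 := (neg_abs_le _).trans' (neg_le_neg (l4.trans (err_bound hn0 hL hnn hb)))
  have ebd : 580 * L ^ 2 / n ≤ L * w := by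
    rw [div_le_iff₀ hn0]
    have : L * w * n * w = 10 * L ^ 2 := by
      calc L * w * n * w = L * (w ^ 2 * n) := by ring
        _ = _ := by rw [hw2]; ring
    have h5 : 1000 * L ^ 2 ≤ L * w * n := by
      have h6 : 0 ≤ L * w * n := by positivity
      nlinarith only [mul_le_mul_of_nonneg_left hw1 h6, this]
    nlinarith only [h5, sq_nonneg L]
  -- the log term
  have hlogml : Real.log n - Real.log m / 2 - Real.log l / 2 ≤ Real.log 2 + L * w := by
    set rho : ℝ := (m - l) / n with hrhod
    have hrn : (m : ℝ) - l = rho * n := by rw [hrhod]; field_simp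
    have hrabs : |rho| ≤ w := by
      rw [hrhod, abs_div, abs_of_pos hn0, div_le_iff₀ hn0]; exact hrho
    have hr2' : rho ^ 2 ≤ w ^ 2 := by
      rw [← sq_abs]; exact pow_le_pow_left₀ (abs_nonneg _) hrabs 2
    have hprod : (m : ℝ) * l = n ^ 2 * (1 - rho ^ 2) / 4 := by
      have h1 : (m : ℝ) = (n + rho * n) / 2 := by linarith
      have h2 : (l : ℝ) = (n - rho * n) / 2 := by linarith
      rw [h1, h2]; ring
    have hpos : 0 < 1 - rho ^ 2 := by linarith only [hr2', hwsq]
    have hlm : Real.log m + Real.log l = 2 * Real.log n + Real.log (1 - rho ^ 2) - 2 * Real.log 2 := by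
      rw [← Real.log_mul hm0.ne' hl0.ne', hprod, Real.log_div (by positivity) (by norm_num),
        Real.log_mul (by positivity) hpos.ne', Real.log_pow]
      have : (4 : ℝ) = 2 ^ 2 := by norm_num
      rw [this, Real.log_pow]
      push_cast
      ring
    have hb := (abs_le.1 (log_one_sub_bound (y := rho ^ 2) (by positivity) (by linarith only [hr2', hwsq]))).1
    have : w ^ 2 ≤ L * w := by nlinarith only [hw, hw1, hL]
    linarith only [this, hb, hlm, hr2']
  -- quadratic
  have hq : ∀ (M X : ℝ), n / 4 ≤ M → |2 * M - n| ≤ w * n →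
      -(X ^ 2 / (2 * M)) + X ^ 2 / n ≤ X ^ 2 * (2 * w / n) := by
    intro M X hM hMn
    have hM0 : 0 < M := by linarith
    have h1 : -(X ^ 2 / (2 * M)) + X ^ 2 / n = X ^ 2 * ((2 * M - n) / (2 * M * n)) := by
      field_simp; ring
    rw [h1]
    apply mul_le_mul_of_nonneg_left _ (by positivity)
    rw [div_le_div_iff₀ (by positivity) hn0]
    have h2 := (le_abs_self _).trans hMn
    have h3 : (2 * M - n) * n ≤ w * n * n := mul_le_mul_of_nonneg_right h2 hn0.le
    have h4 : w * n * n ≤ w * n * (4 * M) := mul_le_mul_of_nonneg_left (by linarith) (by positivity)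
    linarith only [h3, h4]
  have q1 := hq m U hm4 (by have : 2 * (m : ℝ) - n = m - l := by linarith
                            rw [this]; exact hrho)
  have q2 := hq l V hl4 (by have : 2 * (l : ℝ) - n = -(m - l) := by linarith
                            rw [this, abs_neg]; exact hrho)
  have q3 : U ^ 2 * (2 * w / n) + V ^ 2 * (2 * w / n) ≤ 8 * (L * w) := by
    rw [← add_mul]
    calc (U ^ 2 + V ^ 2) * (2 * w / n) ≤ (4 * L * n) * (2 * w / n) :=
          mul_le_mul_of_nonneg_right hUV (by positivity)
      _ = 8 * (L * w) := by field_simp; ring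
  have q4 : (U + V) ^ 2 / (2 * n) + (U - V) ^ 2 / (2 * n) = U ^ 2 / n + V ^ 2 / n := by
    field_simp; ring
  have hs : s ≤ m := by
    have h := (abs_le.1 (show |U| ≤ m / 2 by linarith [aux U m hm4 hU2])).2
    have : (s : ℝ) ≤ m := by linarith
    exact_mod_cast this
  have p1 := pb_pos hs
  have p2 := pb_pos hr
  have p3 : 0 < pb (m + l) (s + r) := pb_pos (by omega)
  have p4 : 0 < pb (m + l) (s + l - r) := pb_pos (by omega)
  rw [← Real.log_le_log_iff (by positivity) (by positivity),
    Real.log_mul p1.ne' p2.ne', Real.log_mul (by positivity) (by positivity),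
    Real.log_mul (by positivity) (by positivity), Real.log_mul p3.ne' p4.ne', Real.log_exp]
  unfold GG at l1 l2 l3 l4
  have hLw : 0 < L * w := by positivity
  linarith


/-- number of agreements -/
def JJ {n : ℕ} (b e : Fin n → Bool) : ℕ := #{k | e k = b k}

theorem JJ_le {n : ℕ} (b e : Fin n → Bool) : JJ b e ≤ n := by
  unfold JJ
  exact (card_filter_le _ _).trans (by simp)

theorem count_pair {n : ℕ} (b b' : Fin n → Bool) (m l : ℕ) (hm : #{k | b k = b' k} = m)
    (hl : #{k | ¬ b k = b' k} = l) (F : ℕ → ℕ → ℝ) :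
    ∑ e : Fin n → Bool, F (JJ b e) (JJ b' e) =
      ∑ s ∈ range (m + 1), ∑ r ∈ range (l + 1),
        ((m.choose s : ℝ) * (l.choose r : ℝ)) * F (s + r) (s + l - r) := by
  set P : Finset (Fin n) := {k | b k = b' k} with hP
  set Q : Finset (Fin n) := {k | ¬ b k = b' k} with hQ
  have step1 : ∑ e : Fin n → Bool, F (JJ b e) (JJ b' e) =
      ∑ Y ∈ P.powerset ×ˢ Q.powerset, F (#Y.1 + #Y.2) (#Y.1 + l - #Y.2) := by
    refine Finset.sum_nbij' (fun e => (P.filter (fun k => e k = b k), Q.filter (fun k => e k = b k)))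
      (fun Y k => if k ∈ Y.1 ∪ Y.2 then b k else !(b k)) ?_ ?_ ?_ ?_ ?_
    · intro e _
      simp only [mem_product, mem_powerset]
      exact ⟨filter_subset _ _, filter_subset _ _⟩
    · intro Y _
      simp
    · intro e _
      funext k
      by_cases h : e k = b k
      · by_cases h' : b k = b' k <;> simp [hP, hQ, h, h']
      · have : e k = !(b k) := by
          cases h1 : e k <;> cases h2 : b k <;> simp_all
        simp [this]
    · rintro ⟨Y1, Y2⟩ hY
      simp only [mem_product, mem_powerset] at hY
      obtain ⟨h1, h2⟩ := hY
      have hPQ : ∀ k, k ∈ P → k ∈ Q → False := by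
        intro k; simp only [hP, hQ, mem_filter, mem_univ, true_and]; intro a b; exact b a
      ext k
      · simp only [mem_filter, mem_union]
        constructor
        · rintro ⟨hk, hk2⟩
          by_contra hc
          have h3 : k ∉ Y2 := fun h => hPQ k hk (h2 h)
          simp [hc, h3] at hk2
        · intro hk
          exact ⟨h1 hk, by simp [hk]⟩
      · simp only [mem_filter, mem_union]
        constructor
        · rintro ⟨hk, hk2⟩
          by_contra hc
          have h3 : k ∉ Y1 := fun h => hPQ k (h1 h) hk
          simp [hc, h3] at hk2
        · intro hk
          exact ⟨h2 hk, by simp [hk]⟩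
    · intro e _
      have e1 : JJ b e = #(P.filter (fun k => e k = b k)) + #(Q.filter (fun k => e k = b k)) := by
        unfold JJ
        rw [hP, hQ, filter_filter, filter_filter]
        rw [← card_filter_add_card_filter_not (s := ({k | e k = b k} : Finset (Fin n))) (fun k => b k = b' k)]
        rw [filter_filter, filter_filter]
        congr 2 <;> (ext k; simp [and_comm])
      have e2 : JJ b' e = #(P.filter (fun k => e k = b k)) + #(Q.filter (fun k => ¬ e k = b k)) := by
        unfold JJ
        rw [hP, hQ, filter_filter, filter_filter]
        rw [← card_filter_add_card_filter_not (s := ({k | e k = b' k} : Finset (Fin n))) (fun k => b k = b' k)]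
        rw [filter_filter, filter_filter]
        congr 2
        · ext k
          simp only [mem_filter, mem_univ, true_and]
          constructor
          · rintro ⟨h1, h2⟩; exact ⟨h2, h1.trans h2.symm⟩
          · rintro ⟨h1, h2⟩; exact ⟨h2.trans h1, h1⟩
        · ext k
          simp only [mem_filter, mem_univ, true_and]
          cases e k <;> cases b k <;> cases b' k <;> simp
      have e3 := card_filter_add_card_filter_not (s := Q) (fun k => e k = b k)
      rw [hl] at e3
      simp only
      rw [e1, e2]
      congr 1
      omega
  rw [step1, sum_product]
  have hin : ∀ Y1 : Finset (Fin n), ∑ Y2 ∈ Q.powerset, F (#Y1 + #Y2) (#Y1 + l - #Y2) =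
      ∑ r ∈ range (l + 1), (l.choose r : ℝ) * F (#Y1 + r) (#Y1 + l - r) := by
    intro Y1
    rw [sum_powerset_apply_card (fun r => F (#Y1 + r) (#Y1 + l - r)) (x := Q), hl]
    simp
  rw [sum_congr rfl (fun Y1 _ => hin Y1)]
  rw [sum_powerset_apply_card (fun s => ∑ r ∈ range (l + 1), (l.choose r : ℝ) * F (s + r) (s + l - r)) (x := P), hm]
  simp only [nsmul_eq_mul, mul_sum, mul_assoc]

theorem count_single {n : ℕ} (b : Fin n → Bool) (f : ℕ → ℝ) :
    ∑ e : Fin n → Bool, f (JJ b e) = ∑ j ∈ range (n + 1), (n.choose j : ℝ) * f j := by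
  rw [count_pair b b n 0 (by simp) (by simp) (fun a _ => f a)]
  simp

/-- normalized expectation -/
def EE {n : ℕ} (f : (Fin n → Bool) → ℝ) : ℝ := (2 ^ n : ℝ)⁻¹ * ∑ e, f e

theorem EE_single {n : ℕ} (b : Fin n → Bool) (f : ℕ → ℝ) :
    EE (fun e => f (JJ b e)) = ∑ j ∈ range (n + 1), pb n j * f j := by
  unfold EE
  rw [count_single, mul_sum]
  refine sum_congr rfl fun j _ => ?_
  unfold pb
  ring

theorem EE_pair {n : ℕ} (b b' : Fin n → Bool) (m l : ℕ) (hm : #{k | b k = b' k} = m)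
    (hl : #{k | ¬ b k = b' k} = l) (F : ℕ → ℕ → ℝ) :
    EE (fun e => F (JJ b e) (JJ b' e)) =
      ∑ s ∈ range (m + 1), ∑ r ∈ range (l + 1), (pb m s * pb l r) * F (s + r) (s + l - r) := by
  have hml : m + l = n := by
    rw [← hm, ← hl, card_filter_add_card_filter_not]; simp
  unfold EE
  rw [count_pair b b' m l hm hl, mul_sum]
  refine sum_congr rfl fun s _ => ?_
  rw [mul_sum]
  refine sum_congr rfl fun r _ => ?_
  unfold pb
  rw [← hml, pow_add]
  field_simp

theorem EE_const {n : ℕ} (c : ℝ) : EE (fun _ : Fin n → Bool => c) = c := by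
  unfold EE
  simp

theorem EE_mono {n : ℕ} {f g : (Fin n → Bool) → ℝ} (h : ∀ e, f e ≤ g e) : EE f ≤ EE g := by
  unfold EE
  exact mul_le_mul_of_nonneg_left (sum_le_sum fun e _ => h e) (by positivity)

theorem EE_add {n : ℕ} (f g : (Fin n → Bool) → ℝ) : EE (fun e => f e + g e) = EE f + EE g := by
  unfold EE
  rw [sum_add_distrib, mul_add]

theorem EE_smul {n : ℕ} (c : ℝ) (f : (Fin n → Bool) → ℝ) : EE (fun e => c * f e) = c * EE f := by
  unfold EE
  rw [← mul_sum]; ring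

theorem EE_sum {n : ℕ} {ι : Type*} (s : Finset ι) (f : ι → (Fin n → Bool) → ℝ) :
    EE (fun e => ∑ i ∈ s, f i e) = ∑ i ∈ s, EE (f i) := by
  unfold EE
  rw [sum_comm, mul_sum]


theorem pb_succ (n j : ℕ) (hj : j ≤ n) : pb n (j + 1) * ((j : ℝ) + 1) = pb n j * ((n : ℝ) - j) := by
  have h := Nat.choose_succ_right_eq n j
  have h' : ((n.choose (j + 1) : ℕ) : ℝ) * ((j : ℝ) + 1) = (n.choose j : ℝ) * ((n : ℝ) - j) := by
    rw [← Nat.cast_sub hj]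
    exact_mod_cast h
  unfold pb
  rw [div_mul_eq_mul_div, h', div_mul_eq_mul_div]

theorem pb_eq_zero {n j : ℕ} (h : n < j) : pb n j = 0 := by
  unfold pb
  rw [Nat.choose_eq_zero_of_lt h]; simp

theorem pb_succ_le {n j₁ j : ℕ} (h : j₁ ≤ j) (hj : j₁ ≤ n) :
    pb n (j + 1) ≤ ((n : ℝ) - j₁) / ((j₁ : ℝ) + 1) * pb n j := by
  have h0 : (0 : ℝ) ≤ (n : ℝ) - j₁ := by
    have : (j₁ : ℝ) ≤ n := by exact_mod_cast hj
    linarith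
  rcases le_or_gt j n with hn | hn
  · have e := pb_succ n j hn
    have hj1 : (j₁ : ℝ) ≤ j := by exact_mod_cast h
    rw [div_mul_eq_mul_div, le_div_iff₀ (by positivity)]
    have p := pb_nonneg n (j + 1)
    have p' := pb_nonneg n j
    calc pb n (j + 1) * ((j₁ : ℝ) + 1) ≤ pb n (j + 1) * ((j : ℝ) + 1) := by gcongr
      _ = pb n j * ((n : ℝ) - j) := e
      _ ≤ pb n j * ((n : ℝ) - j₁) := by gcongr
      _ = _ := by ring
  · rw [pb_eq_zero (by omega)]
    have := pb_nonneg n j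
    positivity

theorem pb_add_le {n j₁ j : ℕ} (h : j₁ ≤ j) (hj : j₁ ≤ n) (i : ℕ) :
    pb n (j + i) ≤ (((n : ℝ) - j₁) / ((j₁ : ℝ) + 1)) ^ i * pb n j := by
  have h0 : (0 : ℝ) ≤ (n : ℝ) - j₁ := by
    have : (j₁ : ℝ) ≤ n := by exact_mod_cast hj
    linarith
  induction i with
  | zero => simp
  | succ i ih =>
    have := pb_succ_le (n := n) (show j₁ ≤ j + i by omega) hj
    rw [← add_assoc]
    refine this.trans ?_
    rw [pow_succ', mul_assoc]
    gcongr

theorem pb_anti {n j : ℕ} (h : n ≤ 2 * j) : pb n (j + 1) ≤ pb n j := by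
  rcases le_or_gt j n with hn | hn
  · have := pb_succ_le (n := n) le_rfl hn
    refine this.trans ?_
    have p := pb_nonneg n j
    have : ((n : ℝ) - j) / ((j : ℝ) + 1) ≤ 1 := by
      rw [div_le_one (by positivity)]
      have : (n : ℝ) ≤ 2 * j := by exact_mod_cast h
      linarith
    nlinarith
  · rw [pb_eq_zero (by omega)]
    exact pb_nonneg n j

theorem pb_anti_add {n j : ℕ} (h : n ≤ 2 * j) (i : ℕ) : pb n (j + i) ≤ pb n j := by
  induction i with
  | zero => simp
  | succ i ih => exact (pb_anti (n := n) (j := j + i) (by omega)).trans ih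

theorem sum_pairs (g : ℕ → ℝ) (j M : ℕ) :
    ∑ a ∈ Ico j (j + 2 * M), g a = ∑ i ∈ range M, (g (j + 2 * i) + g (j + 2 * i + 1)) := by
  induction M with
  | zero => simp
  | succ M ih =>
    rw [sum_range_succ, ← ih]
    have : j + 2 * (M + 1) = j + 2 * M + 1 + 1 := by ring
    rw [this, sum_Ico_succ_top (by omega), sum_Ico_succ_top (by omega)]
    ring

/-- window probability -/
def qq (n j M : ℕ) : ℝ := ∑ a ∈ Ico j (j + 2 * M), pb n a

theorem qq_nonneg (n j M : ℕ) : 0 ≤ qq n j M := sum_nonneg fun _ _ => pb_nonneg _ _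

theorem parity_sum (n j M c : ℕ) (w : ℝ) (hw1 : w ≤ 1 / 2)
    (h1 : n ≤ 2 * j)
    (h2 : ∀ a, j ≤ a → a < j + 2 * M → 2 * (a : ℝ) + 1 - n ≤ w * n) (hw : 0 ≤ w) :
    ∑ a ∈ Ico j (j + 2 * M), (if a % 2 = c then pb n a else 0) ≤ qq n j M / (2 - 2 * w) := by
  rw [le_div_iff₀ (by linarith)]
  unfold qq
  rw [sum_pairs, sum_pairs, sum_mul]
  apply sum_le_sum
  intro i hi
  rw [mem_range] at hi
  set a := j + 2 * i with ha
  have hA : (if a % 2 = c then pb n a else 0) + (if (a + 1) % 2 = c then pb n (a + 1) else 0) ≤ pb n a := by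
    have p0 := pb_nonneg n a
    have p1 := pb_anti (n := n) (j := a) (by omega)
    by_cases h : a % 2 = c
    · have : ¬ (a + 1) % 2 = c := by omega
      simp [h, this]
    · simp only [h, if_false, zero_add]
      split_ifs <;> linarith
  have p0 := pb_nonneg n a
  have hB : (1 - 2 * w) * pb n a ≤ pb n (a + 1) := by
    rcases le_or_gt a n with hn | hn
    · have e := pb_succ n a hn
      have h3 := h2 a (by omega) (by omega)
      have h4 : (n : ℝ) ≤ 2 * a := by exact_mod_cast (show n ≤ 2 * a by omega)
      have h5 : (1 - 2 * w) * ((a : ℝ) + 1) ≤ n - a := by nlinarith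
      have h6 : ((1 - 2 * w) * pb n a) * ((a : ℝ) + 1) ≤ pb n (a + 1) * ((a : ℝ) + 1) := by
        rw [e]
        nlinarith
      exact le_of_mul_le_mul_right h6 (by positivity)
    · rw [pb_eq_zero hn, mul_zero]
      exact pb_nonneg _ _
  have : (0 : ℝ) ≤ 2 - 2 * w := by linarith
  calc _ ≤ pb n a * (2 - 2 * w) := mul_le_mul_of_nonneg_right hA this
    _ ≤ _ := by linarith

theorem second_pair {n : ℕ} (b b' : Fin n → Bool) (m l j M : ℕ) (hm : #{k | b k = b' k} = m)
    (hl : #{k | ¬ b k = b' k} = l) (L w : ℝ)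
    (hL : 1 ≤ L) (hw : 0 < w) (hw2 : w ^ 2 * (n : ℝ) = 10 * L) (hsm : 100 * w * L ≤ 1)
    (hrho : |(m : ℝ) - l| ≤ w * n)
    (hj : n ≤ 2 * j)
    (hwin : ∀ a, j ≤ a → a < j + 2 * M → (2 * (a : ℝ) - n) ^ 2 ≤ 4 * L * n) :
    EE (fun e => (if JJ b e ∈ Ico j (j + 2 * M) then (1 : ℝ) else 0) *
      (if JJ b' e ∈ Ico j (j + 2 * M) then (1 : ℝ) else 0)) ≤ (1 + 44 * L * w) * qq n j M ^ 2 := by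
  have hml : m + l = n := by
    rw [← hm, ← hl, card_filter_add_card_filter_not]; simp
  set W := Ico j (j + 2 * M) with hW
  have hwin' : ∀ a ∈ W, (2 * (a : ℝ) - n) ^ 2 ≤ 4 * L * n := by
    intro a ha
    rw [hW, mem_Ico] at ha
    exact hwin a ha.1 ha.2
  rw [EE_pair b b' m l hm hl (fun x y => (if x ∈ W then (1 : ℝ) else 0) * (if y ∈ W then (1 : ℝ) else 0))]
  rw [← sum_product' (range (m + 1)) (range (l + 1)) (fun s r => (pb m s * pb l r) *
    ((if s + r ∈ W then (1 : ℝ) else 0) * (if s + l - r ∈ W then (1 : ℝ) else 0)))]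
  set K : ℝ := 2 * Real.exp (20 * L * w) with hK
  set h : ℕ × ℕ → ℝ := fun ab => if (ab.1 + ab.2) % 2 = l % 2 then K * (pb n ab.1 * pb n ab.2) else 0 with hh
  have hh0 : ∀ ab, 0 ≤ h ab := by
    intro ab
    simp only [hh]
    have := pb_nonneg n ab.1
    have := pb_nonneg n ab.2
    split_ifs <;> positivity
  set S := ((range (m + 1)) ×ˢ (range (l + 1))).filter (fun x => x.1 + x.2 ∈ W ∧ x.1 + l - x.2 ∈ W) with hS
  have e1 : ∑ x ∈ (range (m + 1)) ×ˢ (range (l + 1)), (pb m x.1 * pb l x.2) *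
    ((if x.1 + x.2 ∈ W then (1 : ℝ) else 0) * (if x.1 + l - x.2 ∈ W then (1 : ℝ) else 0))
      = ∑ x ∈ S, pb m x.1 * pb l x.2 := by
    rw [hS, sum_filter]
    refine sum_congr rfl fun x _ => ?_
    by_cases h1 : x.1 + x.2 ∈ W <;> by_cases h2 : x.1 + l - x.2 ∈ W <;> simp [h1, h2]
  rw [e1]
  have e2 : ∑ x ∈ S, pb m x.1 * pb l x.2 ≤ ∑ x ∈ S, h (x.1 + x.2, x.1 + l - x.2) := by
    apply sum_le_sum
    intro x hx
    simp only [hS, mem_filter, mem_product, mem_range] at hx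
    obtain ⟨⟨hx1, hx2⟩, hx3, hx4⟩ := hx
    have hpar : (x.1 + x.2 + (x.1 + l - x.2)) % 2 = l % 2 := by omega
    simp only [hh, hpar, if_true]
    have ha := hwin' _ hx3
    have hb := hwin' _ hx4
    have := pair_bound m l x.1 x.2 (by omega) L w hL hw (by rw [hml]; exact hw2) hsm
      (by rw [hml]; exact hrho) (by rw [hml]; exact ha) (by rw [hml]; exact hb)
    rw [hml] at this
    exact this
  have e3 : ∑ x ∈ S, h (x.1 + x.2, x.1 + l - x.2) ≤ ∑ ab ∈ W ×ˢ W, h ab := by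
    rw [← sum_image (f := h) (g := fun x : ℕ × ℕ => (x.1 + x.2, x.1 + l - x.2))]
    · apply sum_le_sum_of_subset_of_nonneg
      · intro ab hab
        rw [mem_image] at hab
        obtain ⟨x, hx, rfl⟩ := hab
        simp only [hS, mem_filter] at hx
        exact mem_product.2 hx.2
      · intro ab _ _
        exact hh0 ab
    · intro x hx y hy hxy
      simp only [hS, coe_filter, Set.mem_ofPred_eq, mem_product, mem_range] at hx hy
      simp only [Prod.mk.injEq] at hxy
      ext <;> omega
  refine e2.trans (e3.trans ?_)
  have hw1 : w ≤ 1 / 100 := by nlinarith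
  have hn0 : (0 : ℝ) ≤ n := Nat.cast_nonneg n
  have hwn : 1000 ≤ w * n := by
    have : w * (w * n) = 10 * L := by rw [← hw2]; ring
    have h9 : 0 ≤ w * n := by positivity
    nlinarith only [this, hL, hw1, h9]
  have hpar2 : ∀ a, j ≤ a → a < j + 2 * M → 2 * (a : ℝ) + 1 - n ≤ w * n := by
    intro a h1 h2
    have h3 := hwin a h1 h2
    have h4 : 4 * L * n = 0.4 * (w * n) ^ 2 := by
      have : (w * n) ^ 2 = (w ^ 2 * n) * n := by ring
      rw [this, hw2]; ring
    have h5 : |2 * (a : ℝ) - n| ≤ 0.9 * (w * n) := by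
      apply abs_le_of_sq_le_sq _ (by positivity)
      rw [h4] at h3
      nlinarith only [h3, sq_nonneg (w * n)]
    have := (le_abs_self _).trans h5
    linarith
  have e4 : ∑ ab ∈ W ×ˢ W, h ab ≤ ∑ a ∈ W, K * (pb n a * (qq n j M / (2 - 2 * w))) := by
    rw [sum_product]
    apply sum_le_sum
    intro a _
    have : ∀ bb ∈ W, h (a, bb) = (K * pb n a) * (if bb % 2 = (l + a) % 2 then pb n bb else 0) := by
      intro bb _
      simp only [hh]
      by_cases hc : (a + bb) % 2 = l % 2
      · have : bb % 2 = (l + a) % 2 := by omega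
        rw [if_pos hc, if_pos this]; ring
      · have : ¬ bb % 2 = (l + a) % 2 := by omega
        rw [if_neg hc, if_neg this]; ring
    rw [sum_congr rfl this, ← mul_sum, ← mul_assoc]
    apply mul_le_mul_of_nonneg_left
    · exact parity_sum n j M _ w (by linarith) hj hpar2 hw.le
    · have := pb_nonneg n a
      positivity
  refine e4.trans ?_
  rw [← mul_sum, ← sum_mul]
  have e5 : ∑ a ∈ W, pb n a = qq n j M := rfl
  rw [e5]
  have e6 : K * (qq n j M * (qq n j M / (2 - 2 * w))) = (K / (2 - 2 * w)) * qq n j M ^ 2 := by ring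
  rw [e6]
  apply mul_le_mul_of_nonneg_right _ (by positivity)
  rw [div_le_iff₀ (by linarith), hK]
  have hx : 20 * L * w ≤ 1 := by nlinarith
  have hx0 : 0 ≤ 20 * L * w := by positivity
  have hexp := (abs_le.1 (Real.abs_exp_sub_one_sub_id_le (x := 20 * L * w) (by rw [abs_of_nonneg hx0]; exact hx))).2
  have hLw : 0 < L * w := by positivity
  have hLw2 : L * w ≤ 1 / 100 := by nlinarith
  have hwL : w ≤ L * w := by nlinarith
  nlinarith only [hexp, hLw, hLw2, hwL, hw]

theorem cheb {n : ℕ} (b : Fin n → Fin n → Bool) (j M : ℕ) (L w : ℝ) (hn : 0 < n)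
    (hL : 1 ≤ L) (hw : 0 < w) (hw2 : w ^ 2 * (n : ℝ) = 10 * L) (hsm : 100 * w * L ≤ 1)
    (hrho : ∀ i i' : Fin n, i ≠ i' →
      |((#{k | b i k = b i' k} : ℕ) : ℝ) - ((#{k | ¬ b i k = b i' k} : ℕ) : ℝ)| ≤ w * n)
    (hj : n ≤ 2 * j) (hq : 0 < qq n j M)
    (hwin : ∀ a, j ≤ a → a < j + 2 * M → (2 * (a : ℝ) - n) ^ 2 ≤ 4 * L * n) :
    EE (fun e => if ∀ i, JJ (b i) e < j then (1 : ℝ) else 0) ≤ 1 / (n * qq n j M) + 44 * L * w := by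
  set q := qq n j M with hqd
  set W := Ico j (j + 2 * M) with hW
  set X : Fin n → (Fin n → Bool) → ℝ := fun i e => if JJ (b i) e ∈ W then (1 : ℝ) else 0 with hX
  have hn' : (0 : ℝ) < n := by exact_mod_cast hn
  have hEX : ∀ i, EE (X i) = q := by
    intro i
    rw [hX]
    simp only
    rw [EE_single (b i) (fun x => if x ∈ W then (1 : ℝ) else 0)]
    simp only [mul_ite, mul_one, mul_zero]
    rw [← sum_filter, hqd, qq]
    apply sum_subset
    · intro a ha
      exact (mem_filter.1 ha).2
    · intro a ha ha'
      apply pb_eq_zero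
      simp only [mem_filter, mem_range, not_and'] at ha'
      have := ha' ha
      omega
  have hEXX : ∀ i i', EE (fun e => X i e * X i' e) ≤ (if i = i' then q else 0) + (1 + 44 * L * w) * q ^ 2 := by
    intro i i'
    by_cases h : i = i'
    · subst h
      rw [if_pos rfl]
      have : (fun e => X i e * X i e) = X i := by
        funext e; simp only [hX]; split_ifs <;> simp
      rw [this, hEX]
      have : 0 ≤ (1 + 44 * L * w) * q ^ 2 := by positivity
      linarith
    · rw [if_neg h, zero_add]
      exact second_pair (b i) (b i') _ _ j M rfl rfl L w hL hw hw2 hsm (hrho i i' h) hj hwin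
  have hpt : ∀ e, (n * q) ^ 2 * (if ∀ i, JJ (b i) e < j then (1 : ℝ) else 0) ≤
      ((∑ i, ∑ i', X i e * X i' e) + (-(2 * (n * q))) * ∑ i, X i e) + (n * q) ^ 2 := by
    intro e
    have hs : ∑ i, ∑ i', X i e * X i' e = (∑ i, X i e) ^ 2 := by
      rw [sq, sum_mul_sum]
    rw [hs]
    split_ifs with hc
    · have : ∑ i, X i e = 0 := by
        apply sum_eq_zero
        intro i _
        simp only [hX]
        rw [if_neg]
        rw [hW, mem_Ico]
        have := hc i
        omega
      rw [this]
      simp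
    · nlinarith [sq_nonneg (∑ i, X i e - n * q)]
  have hE := EE_mono hpt
  rw [EE_smul, EE_add, EE_add, EE_const, EE_smul, EE_sum, EE_sum] at hE
  have h1 : ∑ i, EE (X i) = n * q := by
    rw [sum_congr rfl (fun i _ => hEX i)]; simp
  have h2 : ∑ i, EE (fun e => ∑ i', X i e * X i' e) ≤ n * q + (n * q) ^ 2 * (1 + 44 * L * w) := by
    calc _ ≤ ∑ i : Fin n, ∑ i' : Fin n, ((if i = i' then q else 0) + (1 + 44 * L * w) * q ^ 2) := by
          apply sum_le_sum
          intro i _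
          rw [EE_sum]
          exact sum_le_sum fun i' _ => hEXX i i'
      _ = _ := by
          simp only [sum_add_distrib, sum_ite_eq, mem_univ, if_true, sum_const, card_univ, Fintype.card_fin, nsmul_eq_mul]
          ring
  rw [h1] at hE
  have hnq : 0 < n * q := by positivity
  have hfin : (n * q) ^ 2 * EE (fun e => if ∀ i, JJ (b i) e < j then (1 : ℝ) else 0) ≤
      (n * q) ^ 2 * (1 / (n * q) + 44 * L * w) := by
    have : (n * q) ^ 2 * (1 / (n * q)) = n * q := by field_simp
    rw [mul_add, this]
    linarith
  exact le_of_mul_le_mul_left hfin (by positivity)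


/-- sup of absolute row sums -/
def YY {n : ℕ} (b : Fin n → Fin n → Bool) (e : Fin n → Bool) : ℝ :=
  ‖fun i : Fin n => 2 * (JJ (b i) e : ℝ) - n‖

theorem one_sub_ratio {n j : ℕ} (hj : j ≤ n) (hn : n < 2 * j) :
    (2 * (j : ℝ) - n) / n ≤ 1 - ((n : ℝ) - j) / ((j : ℝ) + 1) := by
  have h1 : (j : ℝ) ≤ n := by exact_mod_cast hj
  have h2 : (n : ℝ) < 2 * j := by exact_mod_cast hn
  have hn0 : (0 : ℝ) < n := by linarith
  have : 1 - ((n : ℝ) - j) / ((j : ℝ) + 1) = (2 * j + 1 - n) / (j + 1) := by field_simp; ring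
  rw [this, div_le_div_iff₀ hn0 (by positivity)]
  nlinarith

theorem sum_geom_weight (r : ℝ) (h0 : 0 ≤ r) (h1 : r < 1) (N : ℕ) :
    ∑ i ∈ range N, (i : ℝ) * r ^ i ≤ 1 / (1 - r) ^ 2 := by
  have h : ‖r‖ < 1 := by rwa [Real.norm_of_nonneg h0]
  have hs := hasSum_coe_mul_geometric_of_norm_lt_one h
  have := sum_le_hasSum (range N) (fun i _ => by positivity) hs
  refine this.trans ?_
  have : 0 < (1 - r) ^ 2 := by
    have : 0 < 1 - r := by linarith
    positivity
  gcongr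

theorem pb_symm {n j : ℕ} (h : j ≤ n) : pb n (n - j) = pb n j := by
  unfold pb
  rw [Nat.choose_symm h]

theorem upper_single {n : ℕ} (b : Fin n → Bool) (j₀ : ℕ) (hj : j₀ ≤ n) (hn : n < 2 * j₀) :
    EE (fun e => max (|2 * (JJ b e : ℝ) - n| - (2 * (j₀ : ℝ) - n)) 0) ≤
      4 * (pb n j₀ * ((n : ℝ) ^ 2 / (2 * (j₀ : ℝ) - n) ^ 2)) := by
  rw [EE_single b (fun x => max (|2 * (x : ℝ) - n| - (2 * (j₀ : ℝ) - n)) 0)]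
  have h2 : (n : ℝ) < 2 * j₀ := by exact_mod_cast hn
  have hjn : (j₀ : ℝ) ≤ n := by exact_mod_cast hj
  have hn0 : (0 : ℝ) < n := by linarith
  set g : ℕ → ℝ := fun x => max (2 * (x : ℝ) - 2 * j₀) 0 with hg
  have s1 : ∑ x ∈ range (n + 1), pb n x * max (|2 * (x : ℝ) - n| - (2 * (j₀ : ℝ) - n)) 0 ≤
      ∑ x ∈ range (n + 1), (pb n x * g x + pb n (n - x) * g (n - x)) := by
    apply sum_le_sum
    intro x hx
    rw [mem_range] at hx
    rw [pb_symm (by omega), ← mul_add]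
    apply mul_le_mul_of_nonneg_left _ (pb_nonneg _ _)
    simp only [hg]
    rw [Nat.cast_sub (by omega)]
    have a1 := le_max_left (2 * (x : ℝ) - 2 * j₀) 0
    have a2 := le_max_right (2 * (x : ℝ) - 2 * j₀) 0
    have a3 := le_max_left (2 * ((n : ℝ) - x) - 2 * j₀) 0
    have a4 := le_max_right (2 * ((n : ℝ) - x) - 2 * j₀) 0
    apply max_le
    · rcases abs_cases (2 * (x : ℝ) - n) with h | h <;> linarith
    · linarith
  refine s1.trans ?_
  rw [sum_add_distrib]
  have s2 : ∑ x ∈ range (n + 1), pb n (n - x) * g (n - x) = ∑ x ∈ range (n + 1), pb n x * g x := by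
    have := sum_range_reflect (fun x => pb n x * g x) (n + 1)
    simpa using this
  rw [s2]
  have s3 : ∑ x ∈ range (n + 1), pb n x * g x ≤ 2 * (pb n j₀ * ((n : ℝ) ^ 2 / (2 * (j₀ : ℝ) - n) ^ 2)) := by
    obtain ⟨d, rfl⟩ := Nat.exists_eq_add_of_le hj
    rw [show j₀ + d + 1 = j₀ + (d + 1) by ring, sum_range_add]
    have z : ∑ x ∈ range j₀, pb (j₀ + d) x * g x = 0 := by
      apply sum_eq_zero
      intro x hx
      rw [mem_range] at hx
      have : (x : ℝ) ≤ j₀ := by exact_mod_cast hx.le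
      simp only [hg]
      rw [max_eq_right (by linarith), mul_zero]
    rw [z, zero_add]
    set n := j₀ + d with hnd
    set ρ : ℝ := ((n : ℝ) - j₀) / ((j₀ : ℝ) + 1) with hρ
    have hr := one_sub_ratio hj hn
    rw [← hρ] at hr
    have hρ0 : 0 ≤ ρ := by
      rw [hρ]
      apply div_nonneg <;> linarith
    have hk : 0 < (2 * (j₀ : ℝ) - n) / n := div_pos (by linarith) hn0
    have t1 : ∑ i ∈ range (d + 1), pb n (j₀ + i) * g (j₀ + i) ≤ ∑ i ∈ range (d + 1), (2 * pb n j₀) * ((i : ℝ) * ρ ^ i) := by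
      apply sum_le_sum
      intro i _
      have e : g (j₀ + i) = 2 * i := by
        simp only [hg]
        push_cast
        rw [max_eq_left]
        · ring
        · have : (0 : ℝ) ≤ i := by positivity
          linarith
      rw [e]
      have := pb_add_le (n := n) (le_refl j₀) hj i
      rw [← hρ] at this
      calc pb n (j₀ + i) * (2 * i) ≤ (ρ ^ i * pb n j₀) * (2 * i) := by gcongr
        _ = _ := by ring
    refine t1.trans ?_
    rw [← mul_sum, mul_assoc]
    have t2 := sum_geom_weight ρ hρ0 (by linarith) (d + 1)
    have t3 : 1 / (1 - ρ) ^ 2 ≤ (n : ℝ) ^ 2 / (2 * (j₀ : ℝ) - n) ^ 2 := by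
      have : (n : ℝ) ^ 2 / (2 * (j₀ : ℝ) - n) ^ 2 = 1 / ((2 * (j₀ : ℝ) - n) / n) ^ 2 := by
        rw [div_pow, one_div_div]
      rw [this]
      gcongr
    have := pb_nonneg n j₀
    have t4 := t2.trans t3
    gcongr
  linarith

theorem upper_comb {n : ℕ} (b : Fin n → Fin n → Bool) (j₀ : ℕ) (hj : j₀ ≤ n) (hn : n < 2 * j₀) :
    EE (YY b) ≤ (2 * (j₀ : ℝ) - n) + n * (4 * (pb n j₀ * ((n : ℝ) ^ 2 / (2 * (j₀ : ℝ) - n) ^ 2))) := by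
  have h2 : (n : ℝ) < 2 * j₀ := by exact_mod_cast hn
  have hpt : ∀ e, YY b e ≤ (2 * (j₀ : ℝ) - n) +
      ∑ i, max (|2 * (JJ (b i) e : ℝ) - n| - (2 * (j₀ : ℝ) - n)) 0 := by
    intro e
    have hnn : ∀ i, 0 ≤ max (|2 * (JJ (b i) e : ℝ) - n| - (2 * (j₀ : ℝ) - n)) 0 := fun i => le_max_right _ _
    have hs : 0 ≤ ∑ i, max (|2 * (JJ (b i) e : ℝ) - n| - (2 * (j₀ : ℝ) - n)) 0 :=
      sum_nonneg fun i _ => hnn i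
    unfold YY
    rw [pi_norm_le_iff_of_nonneg (by linarith)]
    intro i
    rw [Real.norm_eq_abs]
    have h1 := single_le_sum (fun i _ => hnn i) (mem_univ i)
    have h3 := le_max_left (|2 * (JJ (b i) e : ℝ) - n| - (2 * (j₀ : ℝ) - n)) 0
    linarith
  refine (EE_mono hpt).trans ?_
  rw [EE_add, EE_const, EE_sum]
  have := sum_le_sum (fun i (_ : i ∈ (univ : Finset (Fin n))) => upper_single (b i) j₀ hj hn)
  simp only [sum_const, card_univ, Fintype.card_fin, nsmul_eq_mul] at this
  linarith

theorem lower_comb {n : ℕ} (b : Fin n → Fin n → Bool) (j₀ j₁ M : ℕ) (L w : ℝ)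
    (hL : 1 ≤ L) (hw : 0 < w) (hw2 : w ^ 2 * (n : ℝ) = 10 * L) (hsm : 100 * w * L ≤ 1)
    (hrho : ∀ i i' : Fin n, i ≠ i' →
      |((#{k | b i k = b i' k} : ℕ) : ℝ) - ((#{k | ¬ b i k = b i' k} : ℕ) : ℝ)| ≤ w * n)
    (hj1 : n < 2 * j₁) (hj : j₁ ≤ j₀) (hj4 : 4 * j₁ ≤ 2 * j₀ + n) (hM : 0 < M) (hjM : j₀ + 2 * M ≤ n)
    (hwin : (2 * ((j₀ + 2 * M : ℕ) : ℝ) - n) ^ 2 ≤ 4 * L * n) :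
    (2 * (j₀ : ℝ) - n) - 2 / ((2 * (j₁ : ℝ) - n) * (M * pb n (j₀ + 2 * M))) - 176 * ((j₀ : ℝ) - j₁) * L * w
      ≤ EE (YY b) := by
  have hn : 0 < n := by omega
  have hn' : (0 : ℝ) < n := by exact_mod_cast hn
  have hj1' : (n : ℝ) < 2 * j₁ := by exact_mod_cast hj1
  have hpt : ∀ e, (2 * (j₀ : ℝ) - n) + (-4) * (∑ j ∈ Ioc j₁ j₀, (if ∀ i, JJ (b i) e < j then (1 : ℝ) else 0))
      ≤ YY b e := by
    intro e
    have hY0 : 0 ≤ YY b e := norm_nonneg _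
    have hYi : ∀ i, 2 * (JJ (b i) e : ℝ) - n ≤ YY b e := by
      intro i
      have := norm_le_pi_norm (fun i : Fin n => 2 * (JJ (b i) e : ℝ) - n) i
      rw [Real.norm_eq_abs] at this
      exact (le_abs_self _).trans this
    -- max of JJ
    obtain ⟨i₀, _, hi₀⟩ := exists_max_image (univ : Finset (Fin n)) (fun i => JJ (b i) e)
      ⟨⟨0, hn⟩, mem_univ _⟩
    set Js := JJ (b i₀) e with hJs
    have hsum : ∑ j ∈ Ioc j₁ j₀, (if ∀ i, JJ (b i) e < j then (1 : ℝ) else 0) =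
        ((j₀ - max j₁ Js : ℕ) : ℝ) := by
      rw [← sum_filter, sum_const, nsmul_eq_mul, mul_one]
      have : (Ioc j₁ j₀).filter (fun j => ∀ i, JJ (b i) e < j) = Ioc (max j₁ Js) j₀ := by
        ext j
        simp only [mem_filter, mem_Ioc]
        constructor
        · rintro ⟨⟨h1, h2⟩, h3⟩
          exact ⟨max_lt h1 (h3 i₀), h2⟩
        · rintro ⟨h1, h2⟩
          exact ⟨⟨lt_of_le_of_lt (le_max_left _ _) h1, h2⟩, fun i =>
            lt_of_le_of_lt ((hi₀ i (mem_univ i)).trans (le_max_right _ _)) h1⟩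
      rw [this, Nat.card_Ioc]
    rw [hsum]
    have hYJ := hYi i₀
    rw [← hJs] at hYJ
    rcases le_total Js j₁ with h | h
    · rw [max_eq_left h, Nat.cast_sub hj]
      have : 4 * (j₁ : ℝ) ≤ 2 * j₀ + n := by exact_mod_cast hj4
      linarith
    · rw [max_eq_right h]
      rcases le_total Js j₀ with h' | h'
      · rw [Nat.cast_sub h']
        have : (Js : ℝ) ≤ j₀ := by exact_mod_cast h'
        linarith
      · rw [Nat.sub_eq_zero_of_le h']
        have : (j₀ : ℝ) ≤ Js := by exact_mod_cast h'
        push_cast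
        linarith
  refine le_trans ?_ (EE_mono hpt)
  rw [EE_add, EE_const, EE_smul, EE_sum]
  set p := pb n (j₀ + 2 * M) with hp
  have hp0 : 0 < p := pb_pos hjM
  have hM' : (0 : ℝ) < M := by exact_mod_cast hM
  set ρ : ℝ := ((n : ℝ) - j₁) / ((j₁ : ℝ) + 1) with hρ
  have hj1n : j₁ ≤ n := by omega
  have hj1n' : (j₁ : ℝ) ≤ n := by exact_mod_cast hj1n
  have hr := one_sub_ratio hj1n hj1
  rw [← hρ] at hr
  have hρ0 : 0 ≤ ρ := by
    rw [hρ]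
    apply div_nonneg <;> linarith
  have hk : 0 < (2 * (j₁ : ℝ) - n) / n := div_pos (by linarith) hn'
  have hterm : ∀ j ∈ Ioc j₁ j₀, EE (fun e => if ∀ i, JJ (b i) e < j then (1 : ℝ) else 0) ≤
      ρ ^ (j₀ - j) * (1 / (n * (2 * M * p))) + 44 * L * w := by
    intro j hjm
    rw [mem_Ioc] at hjm
    have hq : 2 * M * pb n (j + 2 * M) ≤ qq n j M := by
      unfold qq
      have : ∀ a ∈ Ico j (j + 2 * M), pb n (j + 2 * M) ≤ pb n a := by
        intro a ha
        rw [mem_Ico] at ha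
        obtain ⟨d, hd⟩ := Nat.exists_eq_add_of_le ha.2.le
        rw [hd]
        exact pb_anti_add (by omega) d
      have := sum_le_sum this
      simp only [sum_const, Nat.card_Ico, nsmul_eq_mul, add_tsub_cancel_left] at this
      push_cast at this
      exact this
    have hpj : 0 < pb n (j + 2 * M) := pb_pos (by omega)
    have hq0 : 0 < qq n j M := lt_of_lt_of_le (by positivity) hq
    have hc := cheb b j M L w hn hL hw hw2 hsm hrho (by omega) hq0 (by
      intro a h1 h2
      refine le_trans ?_ hwin
      have e1 : (n : ℝ) ≤ 2 * a := by exact_mod_cast (show n ≤ 2 * a by omega)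
      have e2 : (a : ℝ) ≤ ((j₀ + 2 * M : ℕ) : ℝ) := by exact_mod_cast (show a ≤ j₀ + 2 * M by omega)
      apply pow_le_pow_left₀ <;> linarith)
    refine hc.trans ?_
    gcongr
    have hpp : p ≤ ρ ^ (j₀ - j) * pb n (j + 2 * M) := by
      have := pb_add_le (n := n) (j₁ := j₁) (j := j + 2 * M) (by omega) hj1n (j₀ - j)
      rw [show j + 2 * M + (j₀ - j) = j₀ + 2 * M by omega] at this
      exact this
    rw [mul_one_div, div_le_div_iff₀ (by positivity) (by positivity), one_mul]
    have hρp : 0 ≤ ρ ^ (j₀ - j) := by positivity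
    calc n * (2 * M * p) ≤ n * (2 * M * (ρ ^ (j₀ - j) * pb n (j + 2 * M))) := by gcongr
      _ = ρ ^ (j₀ - j) * (n * (2 * M * pb n (j + 2 * M))) := by ring
      _ ≤ ρ ^ (j₀ - j) * (n * qq n j M) := by gcongr
  have hsum := sum_le_sum hterm
  rw [sum_add_distrib, ← sum_mul, sum_const, Nat.card_Ioc, nsmul_eq_mul, Nat.cast_sub hj] at hsum
  have hgeo : ∑ j ∈ Ioc j₁ j₀, ρ ^ (j₀ - j) ≤ n / (2 * (j₁ : ℝ) - n) := by
    have e : ∑ j ∈ Ioc j₁ j₀, ρ ^ (j₀ - j) = ∑ i ∈ range (j₀ - j₁), ρ ^ i := by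
      refine sum_nbij' (fun j => j₀ - j) (fun i => j₀ - i) ?_ ?_ ?_ ?_ ?_
      · intro a ha; rw [mem_Ioc] at ha; rw [mem_range]; omega
      · intro a ha; rw [mem_range] at ha; rw [mem_Ioc]; omega
      · intro a ha; rw [mem_Ioc] at ha; omega
      · intro a ha; rw [mem_range] at ha; omega
      · intro a ha; rfl
    rw [e]
    have := sum_le_hasSum (range (j₀ - j₁)) (fun i _ => by positivity)
      (hasSum_geometric_of_lt_one hρ0 (by linarith))
    refine this.trans ?_
    rw [← one_div, show (n : ℝ) / (2 * (j₁ : ℝ) - n) = 1 / ((2 * (j₁ : ℝ) - n) / n) by rw [one_div_div]]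
    gcongr
  have hk1 : 0 < 2 * (j₁ : ℝ) - n := by linarith
  have hfin : (∑ j ∈ Ioc j₁ j₀, ρ ^ (j₀ - j)) * (1 / (n * (2 * M * p))) ≤
      (1 / 2) * (1 / ((2 * (j₁ : ℝ) - n) * (M * p))) := by
    calc _ ≤ (n / (2 * (j₁ : ℝ) - n)) * (1 / (n * (2 * M * p))) := by gcongr
      _ = _ := by field_simp
  have e2 : 2 / ((2 * (j₁ : ℝ) - n) * (M * p)) = 4 * ((1 / 2) * (1 / ((2 * (j₁ : ℝ) - n) * (M * p)))) := by
    ring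
  rw [e2]
  linarith


theorem T_facts (L T : ℝ) (hL : 100 ≤ L)
    (hT : T = Real.sqrt (2 * L) - Real.log L / (2 * Real.sqrt (2 * L))) :
    T ≤ 3 / 2 * Real.sqrt L ∧ Real.sqrt L ≤ T ∧ -(T ^ 2 / 2) ≤ -L + Real.log L / 2 ∧
      -L + Real.log L / 2 - 1 / 4 ≤ -(T ^ 2 / 2) := by
  set S := Real.sqrt L with hS
  set Q := Real.sqrt (2 * L) with hQ
  have hS2 : S ^ 2 = L := Real.sq_sqrt (by linarith)
  have hQ2 : Q ^ 2 = 2 * L := Real.sq_sqrt (by linarith)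
  have hS0 : 0 ≤ S := Real.sqrt_nonneg _
  have hQ0 : 0 ≤ Q := Real.sqrt_nonneg _
  have hS10 : 10 ≤ S := by
    by_contra h
    push Not at h
    nlinarith only [h, hS2, hS0, hL]
  have hQ1 : Q ≤ 3 / 2 * S := by
    by_contra h
    push Not at h
    nlinarith only [h, hS2, hS0, hL, hQ2]
  have hQ3 : 7 / 5 * S ≤ Q := by
    by_contra h
    push Not at h
    nlinarith only [h, hS2, hS0, hL, hQ2, hQ0]
  have hQpos : 0 < Q := by linarith
  have hl0 : 0 ≤ Real.log L := Real.log_nonneg (by linarith)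
  have hl1 : Real.log L ≤ 2 * S := by
    have : Real.log L = 2 * Real.log S := by
      rw [← hS2, Real.log_pow]; push_cast; ring
    rw [this]
    have := Real.log_le_sub_one_of_pos (x := S) (by linarith)
    linarith
  set z := Real.log L / (2 * Q) with hz
  have hz0 : 0 ≤ z := by positivity
  have hzQ : 2 * (z * Q) = Real.log L := by rw [hz]; field_simp
  have hz1 : z ≤ 5 / 7 := by
    rw [hz, div_le_iff₀ (by positivity)]
    nlinarith only [hl1, hQ3]
  have hT2 : T ^ 2 = 2 * L - Real.log L + z ^ 2 := by
    rw [hT]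
    have : (Q - z) ^ 2 = Q ^ 2 - 2 * (z * Q) + z ^ 2 := by ring
    rw [this, hQ2, hzQ]
  have hz2 : z ^ 2 ≤ 26 / 50 := by nlinarith only [hz0, hz1]
  have hz3 : z ^ 2 ≤ 1 / 2 := by
    have h1 : (2 * (z * Q)) ^ 2 ≤ (2 * S) ^ 2 := by
      rw [hzQ]; exact pow_le_pow_left₀ hl0 hl1 2
    have h2 : z ^ 2 * (2 * L) ≤ L := by
      rw [← hQ2, ← hS2]; nlinarith only [h1]
    nlinarith only [h2, hL]
  refine ⟨?_, ?_, ?_, ?_⟩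
  · rw [hT]; linarith
  · rw [hT]; linarith
  · rw [hT2]; nlinarith only [sq_nonneg z]
  · rw [hT2]; linarith

theorem GG_const : Real.log 2 - Real.log (2 * Real.pi) / 2 ≤ 0 ∧
    -1 ≤ Real.log 2 - Real.log (2 * Real.pi) / 2 := by
  have h4 : Real.log 4 = 2 * Real.log 2 := by
    rw [show (4 : ℝ) = 2 ^ 2 by norm_num, Real.log_pow]; push_cast; ring
  have h1 : Real.log 4 ≤ Real.log (2 * Real.pi) :=
    Real.log_le_log (by norm_num) (by linarith [Real.pi_gt_three])
  have h2 : Real.log (2 * Real.pi) ≤ Real.log 8 :=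
    Real.log_le_log (by positivity) (by linarith [Real.pi_le_four])
  have h8 : Real.log 8 = 3 * Real.log 2 := by
    rw [show (8 : ℝ) = 2 ^ 3 by norm_num, Real.log_pow]; push_cast; ring
  have h3 : 0 < Real.log 2 := Real.log_pos (by norm_num)
  have h5 := Real.log_two_lt_d9
  constructor <;> linarith

theorem pb_an (n j : ℕ) (L : ℝ) (hn : 0 < n) (hL : 100 ≤ L) (hLn : 10 * L ^ 5 ≤ n)
    (hj : (2 * (j : ℝ) - n) ^ 2 ≤ 4 * L * n) :
    |Real.log (pb n j) - GG n (2 * j - n)| ≤ 1 := by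
  have hn' : (0 : ℝ) < n := by exact_mod_cast hn
  have hL4 : 1000000 * L ^ 2 ≤ L ^ 5 := by
    have h3 : (100 : ℝ) ^ 3 ≤ L ^ 3 := pow_le_pow_left₀ (by norm_num) hL 3
    have h2 : 0 ≤ L ^ 2 := by positivity
    calc 1000000 * L ^ 2 = 100 ^ 3 * L ^ 2 := by norm_num
      _ ≤ L ^ 3 * L ^ 2 := mul_le_mul_of_nonneg_right h3 h2
      _ = L ^ 5 := by ring
  have hL1 : L ≤ L ^ 2 := by nlinarith
  have hbig : 580 * L ^ 2 ≤ n := by nlinarith only [hL4, hLn, sq_nonneg L]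
  have hb64 : 64 * L ≤ n := by linarith
  have hk : |2 * (j : ℝ) - n| ≤ n / 2 := by
    apply abs_le_of_sq_le_sq _ (by linarith)
    nlinarith only [hj, hb64, hn']
  refine (llt n j hn (by linarith)).trans ?_
  refine (err_bound hn' (by linarith) (by linarith) hj).trans ?_
  rw [div_le_one hn']
  exact hbig

theorem R_facts (n : ℕ) (L : ℝ) (hn : 0 < n) (hL : 100 ≤ L) (hLn : 10 * L ^ 5 ≤ n) :
    Real.sqrt L * 100 ≤ Real.sqrt n ∧ 10 ≤ Real.sqrt L ∧ Real.sqrt n ^ 2 = n ∧ Real.sqrt L ^ 2 = L := by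
  have h1 : Real.sqrt L ^ 2 = L := Real.sq_sqrt (by linarith)
  have h2 : Real.sqrt n ^ 2 = n := Real.sq_sqrt (by positivity)
  have h0 := Real.sqrt_nonneg L
  have h0' := Real.sqrt_nonneg (n : ℝ)
  have hL4 : 1000000 * L ≤ L ^ 5 := by
    have h3 : (100 : ℝ) ^ 4 ≤ L ^ 4 := pow_le_pow_left₀ (by norm_num) hL 4
    calc 1000000 * L ≤ 100 ^ 4 * L := by nlinarith
      _ ≤ L ^ 4 * L := mul_le_mul_of_nonneg_right h3 (by linarith)
      _ = L ^ 5 := by ring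
  refine ⟨?_, ?_, h2, h1⟩
  · apply le_of_sq_le_sq _ h0'
    rw [mul_pow, h1, h2]
    linarith
  · by_contra h
    push Not at h
    nlinarith only [h, h1, h0, hL]

theorem upper_an {n : ℕ} (b : Fin n → Fin n → Bool) (L T : ℝ) (hn : 0 < n) (hLd : L = Real.log (2 * n))
    (hL : 100 ≤ L) (hLn : 10 * L ^ 5 ≤ n)
    (hT : T = Real.sqrt (2 * L) - Real.log L / (2 * Real.sqrt (2 * L))) :
    EE (YY b) ≤ T * Real.sqrt n + 8 * (Real.sqrt n / Real.sqrt L) := by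
  obtain ⟨t1, t2, t3, t4⟩ := T_facts L T hL hT
  obtain ⟨r1, r2, r3, r4⟩ := R_facts n L hn hL hLn
  have hn' : (0 : ℝ) < n := by exact_mod_cast hn
  set R := Real.sqrt n with hR
  set S := Real.sqrt L with hS
  have hS0 : 0 < S := by linarith
  have hR0 : 0 < R := by linarith
  have hTR : 0 < T * R := by
    have : 0 < T := by linarith
    positivity
  set j₀ := ⌈((n : ℝ) + T * R) / 2⌉₊ with hj₀
  have c1 : ((n : ℝ) + T * R) / 2 ≤ j₀ := Nat.le_ceil _
  have c2 : (j₀ : ℝ) < ((n : ℝ) + T * R) / 2 + 1 := Nat.ceil_lt_add_one (by positivity)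
  have hTR2 : T * R ≤ 3 / 2 * S * R := mul_le_mul_of_nonneg_right t1 hR0.le
  have hSR : 10 * 1000 ≤ S * R := by
    have : 1000 ≤ R := by linarith
    nlinarith only [this, r2]
  have hSRn : S * R * 100 ≤ n := by
    rw [← r3]; nlinarith only [r1, hR0]
  have hk : 2 * (j₀ : ℝ) - n ≤ 2 * (S * R) := by linarith
  have hk0 : T * R ≤ 2 * (j₀ : ℝ) - n := by linarith
  have hjn : j₀ ≤ n := by
    have : (j₀ : ℝ) ≤ n := by linarith
    exact_mod_cast this
  have hn2 : n < 2 * j₀ := by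
    have : (n : ℝ) < 2 * j₀ := by linarith
    exact_mod_cast this
  have hu := upper_comb b j₀ hjn hn2
  have hk2 : (2 * (j₀ : ℝ) - n) ^ 2 ≤ 4 * L * n := by
    calc _ ≤ (2 * (S * R)) ^ 2 := pow_le_pow_left₀ (by linarith) hk 2
      _ = 4 * S ^ 2 * R ^ 2 := by ring
      _ = _ := by rw [r3, r4]
  have hp := (abs_le.1 (pb_an n j₀ L hn hL hLn hk2)).2
  have hk3 : (T * R) ^ 2 ≤ (2 * (j₀ : ℝ) - n) ^ 2 := pow_le_pow_left₀ hTR.le hk0 2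
  have hk4 : T ^ 2 / 2 ≤ (2 * (j₀ : ℝ) - n) ^ 2 / (2 * n) := by
    rw [div_le_div_iff₀ (by norm_num) (by positivity)]
    rw [mul_pow, r3] at hk3
    linarith
  have hlogS : Real.log S = Real.log L / 2 := by rw [hS, Real.log_sqrt (by linarith)]
  have hlogR : Real.log R = Real.log n / 2 := by rw [hR, Real.log_sqrt hn'.le]
  have hpb : pb n j₀ ≤ Real.exp 1 * S / (2 * n * R) := by
    rw [← Real.log_le_log_iff (pb_pos hjn) (by positivity), Real.log_div (by positivity) (by positivity),
      Real.log_mul (by positivity) hS0.ne', Real.log_exp, Real.log_mul (by positivity) hR0.ne', ← hLd, hlogS, hlogR]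
    unfold GG at hp
    linarith [GG_const.1]
  have he : Real.exp 1 ≤ 3 := by linarith [Real.exp_one_lt_d9]
  have hfin : n * (4 * (pb n j₀ * ((n : ℝ) ^ 2 / (2 * (j₀ : ℝ) - n) ^ 2))) ≤ 6 * (R / S) := by
    have hTS : S ^ 2 * R ^ 2 ≤ (2 * (j₀ : ℝ) - n) ^ 2 := by
      refine le_trans ?_ hk3
      rw [mul_pow]
      have : S ^ 2 ≤ T ^ 2 := pow_le_pow_left₀ hS0.le t2 2
      exact mul_le_mul_of_nonneg_right this (by positivity)
    have hp0 := pb_nonneg n j₀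
    calc n * (4 * (pb n j₀ * ((n : ℝ) ^ 2 / (2 * (j₀ : ℝ) - n) ^ 2)))
        ≤ n * (4 * ((3 * S / (2 * n * R)) * ((n : ℝ) ^ 2 / (S ^ 2 * R ^ 2)))) := by
          gcongr
          refine hpb.trans ?_
          gcongr
      _ = 6 * (R / S) * ((n : ℝ) ^ 2 / (R ^ 2) ^ 2) := by field_simp; ring
      _ = 6 * (R / S) := by rw [r3, div_self (by positivity), mul_one]
  have hRS : 1 ≤ R / S := by
    rw [le_div_iff₀ hS0]; linarith
  linarith

theorem lower_an {n : ℕ} (b : Fin n → Fin n → Bool) (L T : ℝ) (hn : 0 < n) (hLd : L = Real.log (2 * n))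
    (hL : 100 ≤ L) (hLn : 10 * L ^ 5 ≤ n)
    (hT : T = Real.sqrt (2 * L) - Real.log L / (2 * Real.sqrt (2 * L)))
    (hrho : ∀ i i' : Fin n, i ≠ i' →
      |((#{k | b i k = b i' k} : ℕ) : ℝ) - ((#{k | ¬ b i k = b i' k} : ℕ) : ℝ)| ≤
        Real.sqrt (10 * L / n) * n) :
    T * Real.sqrt n - (178 + 16 * Real.exp 17) * (Real.sqrt n / Real.sqrt L) ≤ EE (YY b) := by
  obtain ⟨t1, t2, t3, t4⟩ := T_facts L T hL hT
  obtain ⟨r1, r2, r3, r4⟩ := R_facts n L hn hL hLn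
  have hn' : (0 : ℝ) < n := by exact_mod_cast hn
  set R := Real.sqrt n with hR
  set S := Real.sqrt L with hS
  set w := Real.sqrt (10 * L / n) with hw
  have hS0 : 0 < S := by linarith
  have hR0 : 0 < R := by linarith
  have hT0 : 0 < T := by linarith
  have hTR : 0 < T * R := by positivity
  have hw0 : 0 < w := Real.sqrt_pos.2 (by positivity)
  have hwsq : w ^ 2 = 10 * L / n := Real.sq_sqrt (by positivity)
  have hw2 : w ^ 2 * (n : ℝ) = 10 * L := by rw [hwsq]; field_simp
  have hLw : L ^ 2 * w ≤ 1 := by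
    have : (L ^ 2 * w) ^ 2 ≤ 1 := by
      rw [mul_pow, hwsq, mul_div_assoc', div_le_one hn']
      linarith
    have h0 : 0 ≤ L ^ 2 * w := by positivity
    nlinarith only [this, h0]
  have hsm : 100 * w * L ≤ 1 := by
    have : 0 < L * w := by positivity
    nlinarith only [this, hLw, hL]
  have hTR2 : T * R ≤ 3 / 2 * S * R := mul_le_mul_of_nonneg_right t1 hR0.le
  have hTR3 : S * R ≤ T * R := mul_le_mul_of_nonneg_right t2 hR0.le
  have hSR : 10 * 1000 ≤ S * R := by
    have : 1000 ≤ R := by linarith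
    nlinarith only [this, r2]
  have hSRn : S * R * 100 ≤ n := by
    rw [← r3]; nlinarith only [r1, hR0]
  have hRS : 1 ≤ R / S := by
    rw [le_div_iff₀ hS0]; linarith
  have hRS2 : R / S * 100 ≤ S * R := by
    rw [div_mul_eq_mul_div, div_le_iff₀ hS0]
    have : 100 ≤ S * S := by nlinarith only [r2]
    nlinarith only [this, hR0]
  set j₀ := ⌊((n : ℝ) + T * R) / 2⌋₊ with hj₀
  have c1 : (j₀ : ℝ) ≤ ((n : ℝ) + T * R) / 2 := Nat.floor_le (by positivity)
  have c2 : ((n : ℝ) + T * R) / 2 < j₀ + 1 := Nat.lt_floor_add_one _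
  set M := ⌈R / S⌉₊ with hM
  have m1 : R / S ≤ M := Nat.le_ceil _
  have m2 : (M : ℝ) < R / S + 1 := Nat.ceil_lt_add_one (by positivity)
  set j₁ := (2 * j₀ + n) / 4 with hj₁
  have d1 : 4 * j₁ ≤ 2 * j₀ + n := by omega
  have d2 : 2 * j₀ + n < 4 * j₁ + 4 := by omega
  have d2' : 2 * (j₀ : ℝ) + n < 4 * j₁ + 4 := by exact_mod_cast d2
  have hk1 : T * R / 4 ≤ 2 * (j₁ : ℝ) - n := by linarith
  have hn1 : n < 2 * j₁ := by
    have : (n : ℝ) < 2 * j₁ := by linarith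
    exact_mod_cast this
  have hj10 : j₁ ≤ j₀ := by
    have : (n : ℝ) ≤ 2 * j₀ := by linarith
    have : n ≤ 2 * j₀ := by exact_mod_cast this
    omega
  have hM0 : 0 < M := by
    have : (0 : ℝ) < M := by linarith
    exact_mod_cast this
  have hKc : 2 * ((j₀ + 2 * M : ℕ) : ℝ) - n ≤ T * R + 8 * (R / S) := by
    push_cast; linarith
  have hK : 2 * ((j₀ + 2 * M : ℕ) : ℝ) - n ≤ 2 * (S * R) := by linarith
  have hK0 : 0 ≤ 2 * ((j₀ + 2 * M : ℕ) : ℝ) - n := by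
    push_cast
    have : (0 : ℝ) ≤ M := by positivity
    linarith
  have hjM : j₀ + 2 * M ≤ n := by
    have : ((j₀ + 2 * M : ℕ) : ℝ) ≤ n := by linarith
    exact_mod_cast this
  have hK2 : (2 * ((j₀ + 2 * M : ℕ) : ℝ) - n) ^ 2 ≤ 4 * L * n := by
    calc _ ≤ (2 * (S * R)) ^ 2 := pow_le_pow_left₀ hK0 hK 2
      _ = 4 * S ^ 2 * R ^ 2 := by ring
      _ = _ := by rw [r3, r4]
  have hl := lower_comb b j₀ j₁ M L w (by linarith) hw0 hw2 hsm hrho hn1 hj10 d1 hM0 hjM hK2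
  have hp := (abs_le.1 (pb_an n (j₀ + 2 * M) L hn hL hLn hK2)).1
  have hk4 : (2 * ((j₀ + 2 * M : ℕ) : ℝ) - n) ^ 2 / (2 * n) ≤ T ^ 2 / 2 + 14 := by
    have h1 : (2 * ((j₀ + 2 * M : ℕ) : ℝ) - n) ^ 2 ≤ (T * R + 8 * (R / S)) ^ 2 :=
      pow_le_pow_left₀ hK0 hKc 2
    have h2 : (T * R + 8 * (R / S)) ^ 2 = n * (T ^ 2 + 16 * (T / S) + 64 / S ^ 2) := by
      rw [← r3]; field_simp; ring
    have h3 : T / S ≤ 3 / 2 := by rw [div_le_iff₀ hS0]; exact t1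
    have h4 : 64 / S ^ 2 ≤ 1 := by
      rw [r4, div_le_one (by linarith)]; linarith
    rw [div_le_iff₀ (by positivity)]
    rw [h2] at h1
    refine h1.trans ?_
    have h5 : T ^ 2 + 16 * (T / S) + 64 / S ^ 2 ≤ T ^ 2 + 28 := by linarith
    have h6 := mul_le_mul_of_nonneg_left h5 hn'.le
    linarith
  have hlogS : Real.log S = Real.log L / 2 := by rw [hS, Real.log_sqrt (by linarith)]
  have hlogR : Real.log R = Real.log n / 2 := by rw [hR, Real.log_sqrt hn'.le]
  have hpb : Real.exp (-17) * S / (2 * n * R) ≤ pb n (j₀ + 2 * M) := by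
    rw [← Real.log_le_log_iff (by positivity) (pb_pos hjM), Real.log_div (by positivity) (by positivity),
      Real.log_mul (by positivity) hS0.ne', Real.log_exp, Real.log_mul (by positivity) hR0.ne', ← hLd, hlogS, hlogR]
    unfold GG at hp
    linarith [GG_const.2]
  have hMpb : Real.exp (-17) / (2 * n) ≤ M * pb n (j₀ + 2 * M) := by
    calc Real.exp (-17) / (2 * n) = (R / S) * (Real.exp (-17) * S / (2 * n * R)) := by field_simp
      _ ≤ _ := by gcongr
  have hA : 2 / ((2 * (j₁ : ℝ) - n) * (M * pb n (j₀ + 2 * M))) ≤ 16 * Real.exp 17 * (R / S) := by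
    calc 2 / ((2 * (j₁ : ℝ) - n) * (M * pb n (j₀ + 2 * M)))
        ≤ 2 / ((S * R / 4) * (Real.exp (-17) / (2 * n))) := by
          have hk1' : S * R / 4 ≤ 2 * (j₁ : ℝ) - n := by linarith
          have hk2' : 0 < S * R / 4 := by positivity
          exact div_le_div_of_nonneg_left (by norm_num) (by positivity)
            (mul_le_mul hk1' hMpb (by positivity) (by linarith))
      _ = 16 * Real.exp 17 * (n / (S * R)) := by
          rw [Real.exp_neg]; field_simp; norm_num
      _ = _ := by rw [← r3]; field_simp
  have hB : 176 * ((j₀ : ℝ) - j₁) * L * w ≤ 176 * (R / S) := by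
    have h1 : (j₀ : ℝ) - j₁ ≤ S * R := by
      have : (n : ℝ) < 2 * j₁ := by exact_mod_cast hn1
      linarith
    have h2 : S * R * (L * w) ≤ R / S := by
      rw [le_div_iff₀ hS0]
      calc S * R * (L * w) * S = R * (S ^ 2 * L * w) := by ring
        _ = R * (L ^ 2 * w) := by rw [r4]; ring
        _ ≤ R * 1 := by gcongr
        _ = R := mul_one R
    have h3 : ((j₀ : ℝ) - j₁) * (L * w) ≤ S * R * (L * w) := mul_le_mul_of_nonneg_right h1 (by positivity)
    linarith
  linarith


theorem sgn_mul_sum {n : ℕ} (b e : Fin n → Bool) :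
    ∑ k, sgn (b k) * sgn (e k) =
      (#{k | b k = e k} : ℝ) - (#{k | ¬ b k = e k} : ℝ) := by
  have h : ∀ k, sgn (b k) * sgn (e k) =
      (if b k = e k then (1 : ℝ) else 0) - (if ¬ b k = e k then (1 : ℝ) else 0) := by
    intro k
    cases b k <;> cases e k <;> simp [sgn]
  rw [Finset.sum_congr rfl (fun k _ => h k), Finset.sum_sub_distrib, Finset.sum_boole,
    Finset.sum_boole]

theorem sgn_sum_JJ {n : ℕ} (b e : Fin n → Bool) :
    ∑ k, sgn (b k) * sgn (e k) = 2 * (JJ b e : ℝ) - n := by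
  rw [sgn_mul_sum]
  have h1 := Finset.card_filter_add_card_filter_not (s := (Finset.univ : Finset (Fin n)))
    (fun k => b k = e k)
  have h2 : JJ b e = #{k | b k = e k} := by
    unfold JJ
    congr 1
    ext k
    simp [eq_comm]
  rw [Finset.card_univ, Fintype.card_fin] at h1
  have h3 : (#{k | b k = e k} : ℝ) + (#{k | ¬ b k = e k} : ℝ) = n := by exact_mod_cast h1
  rw [h2]
  linarith

theorem sgn_inj : Function.Injective sgn := by
  intro a b h
  cases a <;> cases b <;> simp [sgn] at h ⊢ <;> norm_num at h

theorem badBeta_eq {n : ℕ} (A : Matrix (Fin n) (Fin n) ℝ) (b : Fin n → Fin n → Bool)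
    (hb : ∀ i k, A i k = sgn (b i k)) (c : ℝ) (hc : 0 ≤ c) :
    badBeta (c • A) = c * EE (YY b) := by
  unfold badBeta cube EE
  rw [Finset.sum_image]
  · have h : ∀ e : Fin n → Bool, ‖(c • A).mulVec (fun i => sgn (e i))‖ = c * YY b e := by
      intro e
      rw [Matrix.smul_mulVec, norm_smul, Real.norm_of_nonneg hc]
      unfold YY
      congr 2
      funext i
      rw [← sgn_sum_JJ]
      simp only [Matrix.mulVec, dotProduct, hb]
    rw [Finset.sum_congr rfl (fun e _ => h e), ← Finset.mul_sum]
    ring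
  · intro e _ e' _ h
    funext i
    exact sgn_inj (congrFun h i)

theorem eventually_good : ∃ N : ℕ, ∀ n : ℕ, N ≤ n → 2 ≤ n ∧ 100 ≤ Real.log (2 * n) ∧
    10 * Real.log (2 * n) ^ 5 ≤ n := by
  have ht : Filter.Tendsto (fun n : ℕ => 2 * (n : ℝ)) Filter.atTop Filter.atTop :=
    tendsto_natCast_atTop_atTop.const_mul_atTop (by norm_num)
  have h1 : ∀ᶠ n : ℕ in Filter.atTop, 100 ≤ Real.log (2 * n) :=
    (Real.tendsto_log_atTop.comp ht).eventually_ge_atTop 100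
  have h2 : ∀ᶠ n : ℕ in Filter.atTop,
      ‖Real.log (2 * (n : ℝ)) ^ 5‖ ≤ (1 / 20) * ‖(2 * (n : ℝ))‖ :=
    ht.eventually ((Real.isLittleO_pow_log_id_atTop (n := 5)).bound (by norm_num))
  obtain ⟨N, hN⟩ := Filter.eventually_atTop.1 ((Filter.eventually_ge_atTop 2).and (h1.and h2))
  refine ⟨N, fun n hn => ?_⟩
  obtain ⟨a, b, c⟩ := hN n hn
  refine ⟨a, b, ?_⟩
  rw [Real.norm_of_nonneg (by positivity), Real.norm_of_nonneg (by positivity)] at c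
  linarith

theorem stmt15 : ∃ C : ℝ, 0 < C ∧ ∃ N : ℕ, ∀ n : ℕ, N ≤ n →
    ∀ A : Matrix (Fin n) (Fin n) ℝ,
      (∀ i j, A i j = 1 ∨ A i j = -1) →
      (∀ i j : Fin n, i ≠ j →
        |∑ k : Fin n, A i k * A j k| ≤ Real.sqrt (10 * n * Real.log n)) →
      |badBeta ((Real.sqrt n)⁻¹ • A) -
          (Real.sqrt (2 * Real.log (2 * n)) -
            Real.log (Real.log (2 * n)) / (2 * Real.sqrt (2 * Real.log (2 * n))))| ≤
        C / Real.sqrt (Real.log n) := by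
  obtain ⟨N, hN⟩ := eventually_good
  refine ⟨178 + 16 * Real.exp 17, by positivity, N, fun n hn A hA hrow => ?_⟩
  obtain ⟨hn2, hL, hLn⟩ := hN n hn
  have hn0 : 0 < n := by omega
  have hn' : (2 : ℝ) ≤ n := by exact_mod_cast hn2
  have hb : ∀ i k, A i k = sgn (decide (A i k = 1)) := by
    intro i k
    rcases hA i k with h | h
    · simp [sgn, h]
    · rw [h]; norm_num [sgn]
  obtain ⟨b, hb⟩ : ∃ b : Fin n → Fin n → Bool, ∀ i k, A i k = sgn (b i k) :=
    ⟨fun i k => decide (A i k = 1), hb⟩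
  rw [badBeta_eq A b hb _ (by positivity)]
  generalize hLd : Real.log (2 * (n : ℝ)) = L at *
  generalize hT : Real.sqrt (2 * L) - Real.log L / (2 * Real.sqrt (2 * L)) = T
  have hlogn : 0 < Real.log n := Real.log_pos (by linarith)
  have hle : Real.log n ≤ L := by
    rw [← hLd]
    exact Real.log_le_log (by linarith) (by linarith)
  have hU := upper_an b L T hn0 hLd.symm hL hLn hT.symm
  have hrho : ∀ i i', i ≠ i' → |(#{k | b i k = b i' k} : ℝ) - (#{k | ¬ b i k = b i' k} : ℝ)| ≤
      Real.sqrt (10 * L / n) * n := by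
    intro i i' hii
    have h := hrow i i' hii
    simp only [hb] at h
    rw [sgn_mul_sum] at h
    refine h.trans (Real.sqrt_le_iff.2 ⟨by positivity, ?_⟩)
    rw [mul_pow, Real.sq_sqrt (by positivity)]
    have : 10 * L / (n : ℝ) * (n : ℝ) ^ 2 = 10 * n * L := by field_simp
    rw [this]
    gcongr
  have hLo := lower_an b L T hn0 hLd.symm hL hLn hT.symm hrho
  have hR : 0 < Real.sqrt n := Real.sqrt_pos.2 (by linarith)
  have hS : 0 < Real.sqrt L := Real.sqrt_pos.2 (by linarith)
  have hS2 : 0 < Real.sqrt (Real.log n) := Real.sqrt_pos.2 hlogn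
  have hfin : (178 + 16 * Real.exp 17) / Real.sqrt L ≤
      (178 + 16 * Real.exp 17) / Real.sqrt (Real.log n) :=
    div_le_div_of_nonneg_left (by positivity) hS2 (Real.sqrt_le_sqrt hle)
  refine le_trans ?_ hfin
  have hU2 := mul_le_mul_of_nonneg_left hU (inv_nonneg.2 hR.le)
  have hL2 := mul_le_mul_of_nonneg_left hLo (inv_nonneg.2 hR.le)
  have e1 : (Real.sqrt n)⁻¹ * (T * Real.sqrt n + 8 * (Real.sqrt n / Real.sqrt L)) =
      T + 8 / Real.sqrt L := by field_simp
  have e2 : (Real.sqrt n)⁻¹ * (T * Real.sqrt n -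
      (178 + 16 * Real.exp 17) * (Real.sqrt n / Real.sqrt L)) =
      T - (178 + 16 * Real.exp 17) / Real.sqrt L := by field_simp
  rw [e1] at hU2
  rw [e2] at hL2
  have h8 : 8 / Real.sqrt L ≤ (178 + 16 * Real.exp 17) / Real.sqrt L := by
    gcongr
    linarith [Real.exp_pos 17]
  rw [abs_le]
  constructor <;> linarith
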